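/- arXiv:0908.0906 — 2 statements merged into one kernel-verified Lean document; each statement's English description precedes it below -/
import Mathlib

section
/- Let F be an algebraically closed field and let R = M_n(F) be endowed with a G-grading. Suppose R = C·D = C'·D' are two decompositions of the graded algebra R as in the structure theorem, i.e., C, C' are graded unital subalgebras spanned by homogeneous matrix-unit bases, D, D' are graded unital subalgebras all of whose homogeneous components have dimension at most 1, the multiplication maps C ⊗ D → R and C' ⊗ D' → R are algebra isomorphisms, and the supports of C and D (respectively C' and D') intersect trivially. Then the supports of D and D' coincide (call this common subgroup T) and the associated bicharacters of the division gradings on D and on D' coincide; in particular, D and D' are isomorphic as G-graded algebras. -/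
open TensorProduct

theorem iSupIndep.degree_unique {ι F M : Type*} [Ring F] [AddCommGroup M] [Module F M]
    {ℛ : ι → Submodule F M} (h : iSupIndep ℛ) {g₁ g₂ : ι} {x : M}
    (h₁ : x ∈ ℛ g₁) (h₂ : x ∈ ℛ g₂) (hx : x ≠ 0) : g₁ = g₂ := by
  by_contra hne
  exact hx (Submodule.disjoint_def.mp (h.pairwiseDisjoint hne) x h₁ h₂)

section GradedCorner

variable {F A G : Type*} [Field F] [Ring A] [Algebra F A] [CommGroup G]

/-- A homogeneous idempotent `ε` of degree `1` such that `d ↦ ε * d` identifies the subalgebra `D`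
with the corner `ε A ε` as graded algebras, where the identity component of `D` consists of
scalars. -/
structure IsGradedCorner (ℛ : G → Submodule F A) (D : Subalgebra F A) (ε : A) : Prop where
  mem : ε ∈ ℛ 1
  idem : ε * ε = ε
  ne_zero : ε ≠ 0
  comm : ∀ d ∈ D, d * ε = ε * d
  inj : ∀ d ∈ D, ε * d = 0 → d = 0
  corner : ∀ r, ∃ d ∈ D, ε * r * ε = ε * d
  homogeneous_corner : ∀ g, ∀ r ∈ ℛ g, ∃ d ∈ D, d ∈ ℛ g ∧ ε * r * ε = ε * d
  scalar : ∀ d ∈ D, d ∈ ℛ 1 → ∃ c : F, d = c • 1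

open scoped Pointwise in
/-- In a simple graded algebra, any two nonzero homogeneous elements, the first being an idempotent
of degree `1`, can be linked by homogeneous factors of total degree `1`. -/
theorem exists_homogeneous_link [IsSimpleRing A] {ℛ : G → Submodule F A}
    (hind : iSupIndep ℛ) (htop : iSup ℛ = ⊤)
    (hmul : ∀ g h : G, ∀ x ∈ ℛ g, ∀ y ∈ ℛ h, x * y ∈ ℛ (g * h))
    {ε M : A} {g : G} (hε : ε ∈ ℛ 1) (hidem : ε * ε = ε) (hε0 : ε ≠ 0)
    (hM : M ∈ ℛ g) (hM0 : M ≠ 0) :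
    ∃ h h' : G, ∃ a ∈ ℛ h, ∃ b ∈ ℛ h', h * g * h' = 1 ∧ ε * (a * M * b) * ε ≠ 0 := by
  by_contra! hcon
  have key : ∀ a b, ε * (a * M * b) * ε ∈ ⨆ (j) (_ : j ≠ (1 : G)), ℛ j := by
    intro a b
    have ha : a ∈ iSup ℛ := htop ▸ Submodule.mem_top
    have hb : b ∈ iSup ℛ := htop ▸ Submodule.mem_top
    refine Submodule.iSup_induction ℛ (motive := fun a => ε * (a * M * b) * ε ∈ _) ha ?_ ?_ ?_
    · intro h a ha
      refine Submodule.iSup_induction ℛ (motive := fun b => ε * (a * M * b) * ε ∈ _) hb ?_ ?_ ?_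
      · intro h' b hb
        by_cases h1 : h * g * h' = 1
        · rw [hcon h h' a ha b hb h1]; exact zero_mem _
        · refine Submodule.mem_iSup_of_mem (h * g * h') (Submodule.mem_iSup_of_mem h1 ?_)
          have := hmul _ _ _ (hmul _ _ _ hε _ (hmul _ _ _ (hmul _ _ _ ha _ hM) _ hb)) _ hε
          simpa using this
      · simp
      · intro x y hx hy
        simpa only [mul_add, add_mul] using add_mem hx hy
    · simp
    · intro x y hx hy
      simpa only [mul_add, add_mul] using add_mem hx hy
  have hone : (1 : A) ∈ TwoSidedIdeal.span {M} := by
    rcases eq_bot_or_eq_top (TwoSidedIdeal.span {M}) with h | h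
    · have : M ∈ TwoSidedIdeal.span {M} := TwoSidedIdeal.subset_span rfl
      rw [h] at this
      exact absurd this hM0
    · rw [h]; trivial
  rw [TwoSidedIdeal.mem_span_iff_mem_addSubgroup_closure] at hone
  have hall : ∀ z ∈ AddSubgroup.closure (Set.univ * {M} * Set.univ : Set A),
      ε * z * ε ∈ ⨆ (j) (_ : j ≠ (1 : G)), ℛ j := by
    intro z hz
    induction hz using AddSubgroup.closure_induction with
    | mem x hx =>
      obtain ⟨_, ⟨a, -, m, rfl, rfl⟩, b, -, rfl⟩ := hx
      exact key a b
    | zero => simp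
    | add x y _ _ hx hy => rw [mul_add, add_mul]; exact add_mem hx hy
    | neg x _ hx => rw [mul_neg, neg_mul]; exact neg_mem hx
  have := hall 1 hone
  rw [mul_one, hidem] at this
  exact hε0 (Submodule.disjoint_def.mp (hind 1) ε hε this)

namespace IsGradedCorner

variable {ℛ : G → Submodule F A} {D D' : Subalgebra F A} {ε ε' : A}

theorem cancel (h : IsGradedCorner ℛ D ε) {a b : A} (ha : a ∈ D) (hb : b ∈ D)
    (hab : ε * a = ε * b) : a = b :=
  sub_eq_zero.mp (h.inj _ (sub_mem ha hb) (by rw [mul_sub, hab, sub_self]))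

theorem exists_smul (h : IsGradedCorner ℛ D ε) {r : A} (hr : r ∈ ℛ 1) :
    ∃ c : F, ε * r * ε = c • ε := by
  obtain ⟨d, hd, hd1, hrd⟩ := h.homogeneous_corner 1 r hr
  obtain ⟨c, rfl⟩ := h.scalar d hd hd1
  exact ⟨c, by rw [hrd, mul_smul_comm, mul_one]⟩

/-- Nonzero homogeneous elements of `D` are units. -/
theorem isUnit [IsSimpleRing A] [IsDedekindFiniteMonoid A]
    (hind : iSupIndep ℛ) (htop : iSup ℛ = ⊤)
    (hmul : ∀ g h : G, ∀ x ∈ ℛ g, ∀ y ∈ ℛ h, x * y ∈ ℛ (g * h))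
    (h : IsGradedCorner ℛ D ε) {g : G} {d : A} (hd : d ∈ D) (hdg : d ∈ ℛ g) (hd0 : d ≠ 0) :
    IsUnit d := by
  have hεd : ε * d ∈ ℛ g := by simpa using hmul _ _ _ h.mem _ hdg
  obtain ⟨u, v, a, ha, b, hb, huv, hne⟩ := exists_homogeneous_link hind htop hmul h.mem h.idem
    h.ne_zero hεd (fun h0 => hd0 (h.inj d hd h0))
  obtain ⟨c, hc⟩ := h.exists_smul (r := a * (ε * d) * b)
    (huv ▸ hmul _ _ _ (hmul _ _ _ ha _ hεd) _ hb)
  obtain ⟨a', ha', haa⟩ := h.corner a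
  obtain ⟨b', hb', hbb⟩ := h.corner b
  have hc0 : c ≠ 0 := by
    rintro rfl
    exact hne (by rw [hc, zero_smul])
  have hprod : ε * (a * (ε * d) * b) * ε = ε * (a' * d * b') := by
    calc ε * (a * (ε * d) * b) * ε = ε * (a * (ε * ε * d) * b) * ε := by rw [h.idem]
      _ = ε * a * ε * (ε * d) * b * ε := by simp only [mul_assoc]
      _ = ε * a * ε * (d * ε) * b * ε := by rw [h.comm d hd]
      _ = (ε * a * ε) * d * (ε * b * ε) := by simp only [mul_assoc]
      _ = ε * a' * (d * ε) * b' := by rw [haa, hbb]; simp only [mul_assoc]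
      _ = ε * (a' * ε) * d * b' := by rw [h.comm d hd]; simp only [mul_assoc]
      _ = ε * ε * (a' * d * b') := by rw [h.comm a' ha']; simp only [mul_assoc]
      _ = ε * (a' * d * b') := by rw [h.idem]
  have hs : a' * d * b' = c • (1 : A) := by
    refine h.cancel (D.mul_mem (D.mul_mem ha' hd) hb') (D.smul_mem D.one_mem c) ?_
    rw [← hprod, hc, mul_smul_comm, mul_one]
  have h1 : (c⁻¹ • a') * (d * b') = 1 := by
    rw [smul_mul_assoc, ← mul_assoc, hs, smul_smul, inv_mul_cancel₀ hc0, one_smul]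
  have h2 : d * (b' * (c⁻¹ • a')) = 1 := by
    rw [← mul_assoc]; exact mul_eq_one_symm h1
  exact IsUnit.of_mul_eq_one _ h2

/-- Two corner idempotents of a simple graded algebra are homogeneously equivalent. -/
theorem exists_equivalence [IsSimpleRing A]
    (hind : iSupIndep ℛ) (htop : iSup ℛ = ⊤)
    (hmul : ∀ g h : G, ∀ x ∈ ℛ g, ∀ y ∈ ℛ h, x * y ∈ ℛ (g * h))
    (h : IsGradedCorner ℛ D ε) (h' : IsGradedCorner ℛ D' ε') :
    ∃ g : G, ∃ x ∈ ℛ g, ∃ y ∈ ℛ g⁻¹, x * y = ε ∧ y * x = ε' := by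
  obtain ⟨u, v, a, ha, b, hb, huv, hne⟩ := exists_homogeneous_link hind htop hmul h.mem h.idem
    h.ne_zero h'.mem h'.ne_zero
  obtain ⟨c, hc⟩ := h.exists_smul (r := a * ε' * b)
    (huv ▸ hmul _ _ _ (hmul _ _ _ ha _ h'.mem) _ hb)
  have hc0 : c ≠ 0 := by
    rintro rfl
    exact hne (by rw [hc, zero_smul])
  obtain rfl : v = u⁻¹ := by
    rw [mul_one] at huv
    exact (inv_eq_of_mul_eq_one_right huv).symm
  have hx : ε * a * ε' ∈ ℛ u := by
    simpa using hmul _ _ _ (hmul _ _ _ h.mem _ ha) _ h'.mem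
  have hy : c⁻¹ • (ε' * b * ε) ∈ ℛ u⁻¹ := by
    refine Submodule.smul_mem _ _ ?_
    simpa using hmul _ _ _ (hmul _ _ _ h'.mem _ hb) _ h.mem
  have hxy : ε * a * ε' * (c⁻¹ • (ε' * b * ε)) = ε := by
    have : ε * a * ε' * (ε' * b * ε) = ε * (a * (ε' * ε') * b) * ε := by
      simp only [mul_assoc]
    rw [mul_smul_comm, this, h'.idem, hc, smul_smul, inv_mul_cancel₀ hc0, one_smul]
  refine ⟨u, _, hx, _, hy, hxy, ?_⟩
  set x := ε * a * ε' with hxdef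
  set y := c⁻¹ • (ε' * b * ε) with hydef
  have hxr : x * ε' = x := by rw [hxdef, mul_assoc, h'.idem]
  have hyl : ε' * y = y := by
    rw [hydef, mul_smul_comm, ← mul_assoc, ← mul_assoc, h'.idem]
  have hyr : y * ε = y := by rw [hydef, smul_mul_assoc, mul_assoc, h.idem]
  obtain ⟨l, hl⟩ := h'.exists_smul (r := y * x) (by simpa using hmul _ _ _ hy _ hx)
  have hyx : y * x = l • ε' := by
    rw [← hl, ← mul_assoc ε' y x, hyl, mul_assoc y x ε', hxr]
  have hsq : y * x * (y * x) = y * x := by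
    rw [mul_assoc, ← mul_assoc x y x, hxy, ← mul_assoc, hyr]
  have hl0 : l ≠ 0 := by
    rintro rfl
    rw [zero_smul] at hyx
    apply h.ne_zero
    rw [← h.idem, ← hxy, mul_assoc, ← mul_assoc y x y, hyx, zero_mul, mul_zero]
  rw [hyx, smul_mul_smul_comm, h'.idem] at hsq
  have : l * l = l := smul_left_injective F h'.ne_zero hsq
  have hl1 : l = 1 := by
    exact mul_left_cancel₀ hl0 (by rw [this, mul_one])
  rw [hyx, hl1, one_smul]

/-- The subalgebras attached to two corners of a simple graded algebra are isomorphic as graded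
algebras. -/
theorem exists_gradedEquiv [IsSimpleRing A]
    (hind : iSupIndep ℛ) (htop : iSup ℛ = ⊤)
    (hmul : ∀ g h : G, ∀ x ∈ ℛ g, ∀ y ∈ ℛ h, x * y ∈ ℛ (g * h))
    (h : IsGradedCorner ℛ D ε) (h' : IsGradedCorner ℛ D' ε') :
    ∃ θ : D ≃ₐ[F] D', ∀ g : G, ∀ x : D, (x : A) ∈ ℛ g → (θ x : A) ∈ ℛ g := by
  obtain ⟨u, x, hx, y, hy, hxy, hyx⟩ := h.exists_equivalence hind htop hmul h'
  have corner₁ : ∀ d, ε' * (y * d * x) * ε' = y * (ε * d * ε) * x := by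
    intro d; simp only [← hyx, ← hxy, mul_assoc]
  have corner₂ : ∀ d, ε * (x * d * y) * ε = x * (ε' * d * ε') * y := by
    intro d; simp only [← hyx, ← hxy, mul_assoc]
  have sandwich : ∀ d ∈ D, ε * d * ε = ε * d := fun d hd => by
    rw [mul_assoc, h.comm d hd, ← mul_assoc, h.idem]
  have sandwich' : ∀ d ∈ D', ε' * d * ε' = ε' * d := fun d hd => by
    rw [mul_assoc, h'.comm d hd, ← mul_assoc, h'.idem]
  have ex : ∀ d : D, ∃ d' : D', ε' * (d' : A) = y * (ε * d) * x := fun d => by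
    obtain ⟨e, he, hde⟩ := h'.corner (y * d * x)
    exact ⟨⟨e, he⟩, by rw [← hde, corner₁, sandwich d d.2]⟩
  have ex' : ∀ d : D', ∃ d' : D, ε * (d' : A) = x * (ε' * d) * y := fun d => by
    obtain ⟨e, he, hde⟩ := h.corner (x * d * y)
    exact ⟨⟨e, he⟩, by rw [← hde, corner₂, sandwich' d d.2]⟩
  choose θ hθ using ex
  choose η hη using ex'
  refine ⟨{ toFun := θ, invFun := η, left_inv := ?_, right_inv := ?_, map_mul' := ?_,
            map_add' := ?_, commutes' := ?_ }, ?_⟩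
  · intro d
    refine Subtype.ext (h.cancel (η _).2 d.2 ?_)
    calc ε * (η (θ d) : A) = x * y * (ε * d) * (x * y) := by
          rw [hη, hθ]; simp only [mul_assoc]
      _ = ε * d := by rw [hxy, ← mul_assoc, h.idem, sandwich d d.2]
  · intro d
    refine Subtype.ext (h'.cancel (θ _).2 d.2 ?_)
    calc ε' * (θ (η d) : A) = y * x * (ε' * d) * (y * x) := by
          rw [hθ, hη]; simp only [mul_assoc]
      _ = ε' * d := by rw [hyx, ← mul_assoc, h'.idem, sandwich' d d.2]
  · intro a b
    refine Subtype.ext (h'.cancel (θ _).2 (D'.mul_mem (θ a).2 (θ b).2) ?_)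
    calc ε' * (θ (a * b) : A) = y * (ε * a * b) * x := by
          rw [hθ, Subalgebra.coe_mul, ← mul_assoc ε]
      _ = y * (ε * a * ε * b) * x := by rw [sandwich a a.2]
      _ = y * (ε * a * (x * y) * (ε * b)) * x := by
          rw [hxy, ← mul_assoc _ ε (b : A), mul_assoc _ ε ε, h.idem]
      _ = (y * (ε * a) * x) * (y * (ε * b) * x) := by simp only [mul_assoc]
      _ = ε' * θ a * ε' * θ b := by rw [← hθ, ← hθ]; simp only [mul_assoc]
      _ = ε' * (θ a * θ b) := by rw [sandwich' _ (θ a).2, mul_assoc]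
  · intro a b
    refine Subtype.ext (h'.cancel (θ _).2 (D'.add_mem (θ a).2 (θ b).2) ?_)
    rw [hθ, Subalgebra.coe_add, Subalgebra.coe_add, mul_add, mul_add, mul_add, add_mul, hθ, hθ]
  · intro c
    refine Subtype.ext (h'.cancel (θ _).2 (algebraMap F D' c).2 ?_)
    rw [hθ, Subalgebra.coe_algebraMap, Subalgebra.coe_algebraMap, Algebra.algebraMap_eq_smul_one, mul_smul_comm, mul_smul_comm, mul_one, mul_smul_comm,
      smul_mul_assoc, mul_one]
    congr 1
    calc y * ε * x = (y * x) * (y * x) := by rw [← hxy]; simp only [mul_assoc]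
      _ = ε' := by rw [hyx, h'.idem]
  · intro g d hd
    have hmem : y * d * x ∈ ℛ g := by
      have := hmul _ _ _ (hmul _ _ _ hy _ hd) _ hx
      rwa [mul_comm u⁻¹ g, inv_mul_cancel_right] at this
    obtain ⟨e, he, heg, hde⟩ := h'.homogeneous_corner g _ hmem
    have : (θ d : A) = e := h'.cancel (θ d).2 he (by rw [hθ, ← hde, corner₁, sandwich d d.2])
    change (θ d : A) ∈ ℛ g
    rwa [this]

/-- A homogeneous diagonal matrix unit of `C` is a corner idempotent for `D` in `A = C ⊗ D`. -/
theorem of_matrixUnits [FiniteDimensional F A] (hind : iSupIndep ℛ)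
    (hmul : ∀ g h : G, ∀ x ∈ ℛ g, ∀ y ∈ ℛ h, x * y ∈ ℛ (g * h))
    {C : Subalgebra F A} {k : ℕ} {E : Fin k → Fin k → A} (ψ : (C ⊗[F] D) ≃ₐ[F] A)
    (hE₁ : ∀ i j, ∃ g : G, E i j ∈ ℛ g)
    (hE₂ : ∀ i j p q, E i j * E p q = if j = p then E i q else 0)
    (hE₃ : (∑ i, E i i) = 1) (hE0 : ∀ i, E i i ≠ 0)
    (hE₅ : Submodule.span F (Set.range fun p : Fin k × Fin k => E p.1 p.2)
      = Subalgebra.toSubmodule C)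
    (hDgr : Subalgebra.toSubmodule D = ⨆ g : G, (Subalgebra.toSubmodule D ⊓ ℛ g))
    (hDdiv : ∀ g : G, Module.finrank F ↥(Subalgebra.toSubmodule D ⊓ ℛ g) ≤ 1)
    (hψ : ∀ (c : C) (d : D), ψ (c ⊗ₜ[F] d) = (c : A) * (d : A)) (i : Fin k) :
    IsGradedCorner ℛ D (E i i) := by
  have idem : ∀ j, E j j * E j j = E j j := fun j => by rw [hE₂, if_pos rfl]
  have mem : ∀ j, E j j ∈ ℛ 1 := fun j => by
    obtain ⟨g, hg⟩ := hE₁ j j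
    have h2 := hmul _ _ _ hg _ hg
    rw [idem] at h2
    have : g = 1 := by simpa using hind.degree_unique h2 hg (hE0 j)
    rwa [← this]
  have hEC : ∀ p q, E p q ∈ C := fun p q => by
    rw [← Subalgebra.mem_toSubmodule, ← hE₅]
    exact Submodule.subset_span ⟨(p, q), rfl⟩
  have hcomm : ∀ c ∈ C, ∀ d ∈ D, d * c = c * d := fun c hc d hd => by
    have h1 := hψ ⟨c, hc⟩ 1
    have h2 := hψ 1 ⟨d, hd⟩
    simp only [OneMemClass.coe_one, one_mul, mul_one] at h1 h2
    calc d * c = ψ (1 ⊗ₜ[F] ⟨d, hd⟩) * ψ (⟨c, hc⟩ ⊗ₜ[F] 1) := by rw [h1, h2]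
      _ = c * d := by
        rw [← map_mul, Algebra.TensorProduct.tmul_mul_tmul, one_mul, mul_one, hψ]
  have one_mem : (1 : A) ∈ ℛ 1 := hE₃ ▸ sum_mem fun j _ => mem j
  have one_ne : (1 : A) ≠ 0 := fun h => hE0 i (by rw [← mul_one (E i i), h, mul_zero])
  have hspan : ∀ c ∈ C, ∃ l : F, E i i * c * E i i = l • E i i := by
    intro c hc
    rw [← Subalgebra.mem_toSubmodule, ← hE₅] at hc
    induction hc using Submodule.span_induction with
    | mem x hx =>
      obtain ⟨⟨p, q⟩, rfl⟩ := hx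
      by_cases hp : i = p <;> by_cases hq : q = i
      · exact ⟨1, by simp [hE₂, hp, hq]⟩
      · exact ⟨0, by simp [hE₂, hp, hp ▸ hq]⟩
      · exact ⟨0, by simp [hE₂, hp]⟩
      · exact ⟨0, by simp [hE₂, hp]⟩
    | zero => exact ⟨0, by simp⟩
    | add x y _ _ hx hy =>
      obtain ⟨l, hl⟩ := hx
      obtain ⟨m, hm⟩ := hy
      exact ⟨l + m, by rw [mul_add, add_mul, hl, hm, add_smul]⟩
    | smul a x _ hx =>
      obtain ⟨l, hl⟩ := hx
      exact ⟨a * l, by rw [mul_smul_comm, smul_mul_assoc, hl, smul_smul]⟩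
  have corner : ∀ r, ∃ d ∈ D, E i i * r * E i i = E i i * d := by
    intro r
    obtain ⟨t, rfl⟩ := ψ.surjective r
    induction t using TensorProduct.induction_on with
    | zero => exact ⟨0, D.zero_mem, by simp⟩
    | add s t hs ht =>
      obtain ⟨a, ha, hs⟩ := hs
      obtain ⟨b, hb, ht⟩ := ht
      exact ⟨a + b, D.add_mem ha hb, by rw [map_add, mul_add, add_mul, hs, ht, mul_add]⟩
    | tmul c d =>
      obtain ⟨l, hl⟩ := hspan c c.2
      refine ⟨l • (d : A), D.smul_mem d.2 l, ?_⟩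
      rw [hψ, mul_assoc, mul_assoc, hcomm _ (hEC i i) d d.2, ← mul_assoc, ← mul_assoc, hl,
        smul_mul_assoc, mul_smul_comm]
  refine ⟨mem i, idem i, hE0 i, hcomm _ (hEC i i), ?_, corner, ?_, ?_⟩
  · intro d hd h0
    rw [← one_mul d, ← hE₃, Finset.sum_mul]
    refine Finset.sum_eq_zero fun j _ => ?_
    calc E j j * d = E j i * (E i i * E i j) * d := by simp [hE₂]
      _ = E j i * (E i i * d) * E i j := by
        rw [mul_assoc, mul_assoc, ← hcomm _ (hEC i j) d hd]; simp only [mul_assoc]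
      _ = 0 := by rw [h0, mul_zero, zero_mul]
  · intro g r hr
    obtain ⟨d, hd, hrd⟩ := corner r
    rw [← Subalgebra.mem_toSubmodule, hDgr, iSup_split_single _ g, Submodule.mem_sup] at hd
    obtain ⟨a, ⟨haD, hag⟩, b, hb, rfl⟩ := hd
    refine ⟨a, haD, hag, ?_⟩
    have hEb : E i i * b ∈ ⨆ (j) (_ : j ≠ g), ℛ j := by
      have hle : (⨆ (j) (_ : j ≠ g), Subalgebra.toSubmodule D ⊓ ℛ j) ≤
          (⨆ (j) (_ : j ≠ g), ℛ j).comap (LinearMap.mulLeft F (E i i)) := by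
        refine iSup₂_le fun j hj z hz => ?_
        refine Submodule.mem_iSup_of_mem j (Submodule.mem_iSup_of_mem hj ?_)
        simpa using hmul _ _ _ (mem i) _ hz.2
      exact hle hb
    have hEr : E i i * r * E i i ∈ ℛ g := by
      simpa using hmul _ _ _ (hmul _ _ _ (mem i) _ hr) _ (mem i)
    have hEa : E i i * a ∈ ℛ g := by simpa using hmul _ _ _ (mem i) _ hag
    have hb' : E i i * b = E i i * r * E i i - E i i * a := by rw [hrd, mul_add, add_sub_cancel_left]
    have h0 := Submodule.disjoint_def.mp (hind g) (E i i * b)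
      (hb' ▸ sub_mem hEr hEa) hEb
    rw [hrd, mul_add, h0, add_zero]
  · intro d hd hd1
    obtain ⟨v, hv⟩ := finrank_le_one_iff.mp (hDdiv 1)
    obtain ⟨a, ha⟩ := hv ⟨1, D.one_mem, one_mem⟩
    obtain ⟨b, hb⟩ := hv ⟨d, hd, hd1⟩
    have ha' : a • (v : A) = 1 := congrArg Subtype.val ha
    have hb' : b • (v : A) = d := congrArg Subtype.val hb
    have ha0 : a ≠ 0 := by
      rintro rfl
      exact one_ne (by rw [← ha', zero_smul])
    exact ⟨b * a⁻¹, by rw [← ha', smul_smul, inv_mul_cancel_right₀ ha0, hb']⟩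

end IsGradedCorner

/-- A graded algebra embedding of `D` into `D'` embeds the support of `D` into that of `D'`. -/
theorem support_subset_of_gradedEquiv {ι : Type*} {ℛ : ι → Submodule F A}
    {D D' : Subalgebra F A} (θ : D ≃ₐ[F] D')
    (hθ : ∀ g : ι, ∀ x : D, (x : A) ∈ ℛ g → (θ x : A) ∈ ℛ g) :
    {g : ι | Subalgebra.toSubmodule D ⊓ ℛ g ≠ ⊥} ⊆
      {g : ι | Subalgebra.toSubmodule D' ⊓ ℛ g ≠ ⊥} := by
  intro g hg
  obtain ⟨d, ⟨hd, hdg⟩, hd0⟩ := Submodule.exists_mem_ne_zero_of_ne_bot hg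
  refine (Submodule.ne_bot_iff _).mpr ⟨θ ⟨d, hd⟩, ⟨(θ _).2, hθ g ⟨d, hd⟩ hdg⟩, fun h0 => hd0 ?_⟩
  have : θ ⟨d, hd⟩ = 0 := Subtype.ext h0
  exact congrArg Subtype.val ((map_eq_zero_iff θ θ.injective).mp this)

end GradedCorner

set_option synthInstance.maxHeartbeats 1000000 in
set_option maxHeartbeats 1000000 in
/-- If a `G`-graded `Mₙ(F)` has two decompositions `R = C·D = C'·D'` as
in the structure theorem, then the supports of `D` and `D'` coincide and the
associated bicharacters coincide; in particular `D ≅ D'` as `G`-graded algebras. -/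
theorem matrix_grading_structure_uniqueness
    {F : Type*} [Field F] [IsAlgClosed F]
    {G : Type*} [CommGroup G] [DecidableEq G] {n : ℕ} (hn : 0 < n)
    (ℛ : G → Submodule F (Matrix (Fin n) (Fin n) F))
    (hinternal : DirectSum.IsInternal ℛ)
    (hmul : ∀ g h : G, ∀ x ∈ ℛ g, ∀ y ∈ ℛ h, x * y ∈ ℛ (g * h))
    (C D C' D' : Subalgebra F (Matrix (Fin n) (Fin n) F))
    {k k' : ℕ}
    (E : Fin k → Fin k → Matrix (Fin n) (Fin n) F)
    (E' : Fin k' → Fin k' → Matrix (Fin n) (Fin n) F)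
    (ψ : (↥C ⊗[F] ↥D) ≃ₐ[F] Matrix (Fin n) (Fin n) F)
    (ψ' : (↥C' ⊗[F] ↥D') ≃ₐ[F] Matrix (Fin n) (Fin n) F)
    -- the first decomposition
    (hE₁ : ∀ i j, ∃ g : G, E i j ∈ ℛ g)
    (hE₂ : ∀ i j p q, E i j * E p q = if j = p then E i q else 0)
    (hE₃ : (∑ i, E i i) = 1)
    (hE₄ : LinearIndependent F (fun p : Fin k × Fin k => E p.1 p.2))
    (hE₅ : Submodule.span F (Set.range fun p : Fin k × Fin k => E p.1 p.2)
      = Subalgebra.toSubmodule C)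
    (hCgr : Subalgebra.toSubmodule C = ⨆ g : G, (Subalgebra.toSubmodule C ⊓ ℛ g))
    (hDgr : Subalgebra.toSubmodule D = ⨆ g : G, (Subalgebra.toSubmodule D ⊓ ℛ g))
    (hDdiv : ∀ g : G, Module.finrank F ↥(Subalgebra.toSubmodule D ⊓ ℛ g) ≤ 1)
    (hψ : ∀ (c : C) (d : D), ψ (c ⊗ₜ[F] d)
      = (c : Matrix (Fin n) (Fin n) F) * (d : Matrix (Fin n) (Fin n) F))
    (hsupp : {g : G | Subalgebra.toSubmodule C ⊓ ℛ g ≠ ⊥}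
      ∩ {g : G | Subalgebra.toSubmodule D ⊓ ℛ g ≠ ⊥} = ({1} : Set G))
    -- the second decomposition
    (hE'₁ : ∀ i j, ∃ g : G, E' i j ∈ ℛ g)
    (hE'₂ : ∀ i j p q, E' i j * E' p q = if j = p then E' i q else 0)
    (hE'₃ : (∑ i, E' i i) = 1)
    (hE'₄ : LinearIndependent F (fun p : Fin k' × Fin k' => E' p.1 p.2))
    (hE'₅ : Submodule.span F (Set.range fun p : Fin k' × Fin k' => E' p.1 p.2)
      = Subalgebra.toSubmodule C')
    (hC'gr : Subalgebra.toSubmodule C' = ⨆ g : G, (Subalgebra.toSubmodule C' ⊓ ℛ g))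
    (hD'gr : Subalgebra.toSubmodule D' = ⨆ g : G, (Subalgebra.toSubmodule D' ⊓ ℛ g))
    (hD'div : ∀ g : G, Module.finrank F ↥(Subalgebra.toSubmodule D' ⊓ ℛ g) ≤ 1)
    (hψ' : ∀ (c : C') (d : D'), ψ' (c ⊗ₜ[F] d)
      = (c : Matrix (Fin n) (Fin n) F) * (d : Matrix (Fin n) (Fin n) F))
    (hsupp' : {g : G | Subalgebra.toSubmodule C' ⊓ ℛ g ≠ ⊥}
      ∩ {g : G | Subalgebra.toSubmodule D' ⊓ ℛ g ≠ ⊥} = ({1} : Set G))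
    -- the associated bicharacters of D and D'
    (β β' : G → G → Fˣ)
    (hβ : ∀ u v : G, ∀ x ∈ Subalgebra.toSubmodule D ⊓ ℛ u,
      ∀ y ∈ Subalgebra.toSubmodule D ⊓ ℛ v, x * y = (β u v : F) • (y * x))
    (hβ' : ∀ u v : G, ∀ x ∈ Subalgebra.toSubmodule D' ⊓ ℛ u,
      ∀ y ∈ Subalgebra.toSubmodule D' ⊓ ℛ v, x * y = (β' u v : F) • (y * x)) :
    -- conclusions: supports and bicharacters coincide, and D ≅ D' as graded algebras
    {g : G | Subalgebra.toSubmodule D ⊓ ℛ g ≠ ⊥}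
      = {g : G | Subalgebra.toSubmodule D' ⊓ ℛ g ≠ ⊥} ∧
    (∀ u ∈ {g : G | Subalgebra.toSubmodule D ⊓ ℛ g ≠ ⊥},
      ∀ v ∈ {g : G | Subalgebra.toSubmodule D ⊓ ℛ g ≠ ⊥}, β u v = β' u v) ∧
    ∃ θ : ↥D ≃ₐ[F] ↥D', ∀ g : G, ∀ x : D,
      (x : Matrix (Fin n) (Fin n) F) ∈ ℛ g →
        ((θ x : D') : Matrix (Fin n) (Fin n) F) ∈ ℛ g := by
  have hind := hinternal.submodule_iSupIndep
  have htop := hinternal.submodule_iSup_eq_top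
  have : Nonempty (Fin n) := ⟨⟨0, hn⟩⟩
  have nonempty : ∀ {m : ℕ} (e : Fin m → Fin m → Matrix (Fin n) (Fin n) F),
      (∑ i, e i i) = 1 → Nonempty (Fin m) := by
    intro m e he
    by_contra hm
    rw [not_nonempty_iff] at hm
    rw [Finset.univ_eq_empty, Finset.sum_empty] at he
    exact zero_ne_one he
  obtain ⟨i⟩ := nonempty E hE₃
  obtain ⟨i'⟩ := nonempty E' hE'₃
  have h := IsGradedCorner.of_matrixUnits hind hmul ψ hE₁ hE₂ hE₃ (fun j => hE₄.ne_zero (j, j))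
    hE₅ hDgr hDdiv hψ i
  have h' := IsGradedCorner.of_matrixUnits hind hmul ψ' hE'₁ hE'₂ hE'₃
    (fun j => hE'₄.ne_zero (j, j)) hE'₅ hD'gr hD'div hψ' i'
  obtain ⟨θ, hθ⟩ := h.exists_gradedEquiv hind htop hmul h'
  obtain ⟨η, hη⟩ := h'.exists_gradedEquiv hind htop hmul h
  refine ⟨(support_subset_of_gradedEquiv θ hθ).antisymm (support_subset_of_gradedEquiv η hη),
    ?_, θ, hθ⟩
  intro u hu v hv
  obtain ⟨a, ⟨ha, hau⟩, ha0⟩ := Submodule.exists_mem_ne_zero_of_ne_bot hu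
  obtain ⟨b, ⟨hb, hbv⟩, hb0⟩ := Submodule.exists_mem_ne_zero_of_ne_bot hv
  have hba : b * a ≠ 0 := fun h0 =>
    ha0 ((h.isUnit hind htop hmul hb hbv hb0).mul_right_eq_zero.mp h0)
  have hab : (⟨a, ha⟩ * ⟨b, hb⟩ : D) = (β u v : F) • (⟨b, hb⟩ * ⟨a, ha⟩ : D) :=
    Subtype.ext (hβ u v a ⟨ha, hau⟩ b ⟨hb, hbv⟩)
  have hab' : θ ⟨a, ha⟩ * θ ⟨b, hb⟩ = (β' u v : F) • (θ ⟨b, hb⟩ * θ ⟨a, ha⟩) :=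
    Subtype.ext (hβ' u v _ ⟨(θ _).2, hθ u ⟨a, ha⟩ hau⟩ _ ⟨(θ _).2, hθ v ⟨b, hb⟩ hbv⟩)
  rw [← map_mul, ← map_mul, ← map_smul, θ.injective.eq_iff, hab] at hab'
  have hne : (⟨b, hb⟩ * ⟨a, ha⟩ : D) ≠ 0 := fun h0 => hba (congrArg Subtype.val h0)
  exact Units.ext (smul_left_injective F hne hab')
end

section
/- Let F be an algebraically closed field with char F ≠ 2, let n ≥ 5 with n ≠ 8, and let L = so_n(F) = {X ∈ M_n(F) : Xᵀ = −X}, a Lie algebra under the commutator bracket. Let G be an abelian group and L = ⊕_{g∈G} L_g a G-grading of the Lie algebra L (a vector space decomposition with [L_g, L_h] ⊆ L_{gh}). Then there exists a G-grading M_n(F) = ⊕_{g∈G} R_g of the associative algebra M_n(F) such that Xᵀ ∈ R_g whenever X ∈ R_g (each component is invariant under transpose), and L_g = R_g ∩ L for all g ∈ G. -/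
open Matrix
/-- The subspace of skew-symmetric matrices, i.e. the Lie algebra `so_n(F)`. -/
def skewMatrix (F : Type*) [Field F] (n : ℕ) :
    Submodule F (Matrix (Fin n) (Fin n) F) where
  carrier := {X | Xᵀ = -X}
  add_mem' := fun {a b} ha hb => by
    simp only [Set.mem_setOf_eq] at *
    rw [Matrix.transpose_add, ha, hb, neg_add]
  zero_mem' := by simp
  smul_mem' := fun c a ha => by
    simp only [Set.mem_setOf_eq] at *
    rw [Matrix.transpose_smul, ha, smul_neg]

section wedge
variable {R : Type*} [CommRing R] {ι : Type*}

/-- The skew-symmetric matrix `u vᵀ - v uᵀ`. -/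
def wedge (u v : ι → R) : Matrix ι ι R := vecMulVec u v - vecMulVec v u

theorem wedge_apply (u v : ι → R) (i j : ι) : wedge u v i j = u i * v j - v i * u j := rfl

theorem transpose_wedge (u v : ι → R) : (wedge u v)ᵀ = -wedge u v := by
  ext i j
  simp only [transpose_apply, wedge_apply, Matrix.neg_apply]
  ring

variable [Fintype ι]

theorem vecMul_of_skew {y : Matrix ι ι R} (hy : yᵀ = -y) (v : ι → R) :
    v ᵥ* y = -(y *ᵥ v) := by
  rw [← mulVec_transpose, hy, neg_mulVec]

theorem lie_wedge {y : Matrix ι ι R} (hy : yᵀ = -y) (a b : ι → R) :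
    ⁅y, wedge a b⁆ = wedge (y *ᵥ a) b + wedge a (y *ᵥ b) := by
  ext i j
  simp only [Ring.lie_def, wedge, mul_sub, sub_mul, mul_vecMulVec, vecMulVec_mul,
    vecMul_of_skew hy]
  simp only [Matrix.sub_apply, Matrix.add_apply, vecMulVec_apply, Pi.neg_apply]
  ring

theorem lie_transpose_skew {y s : Matrix ι ι R} (hy : yᵀ = -y) (hs : sᵀ = -s) :
    ⁅y, s⁆ᵀ = -⁅y, s⁆ := by
  simp only [Ring.lie_def, transpose_sub, transpose_mul, hy, hs]
  noncomm_ring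

theorem dotProduct_mulVec_skew {y : Matrix ι ι R} (hy : yᵀ = -y) (a b : ι → R) :
    a ⬝ᵥ y *ᵥ b = -((y *ᵥ a) ⬝ᵥ b) := by
  rw [dotProduct_mulVec, vecMul_of_skew hy, neg_dotProduct]

end wedge

section skew_triple
variable {F : Type*} [Field F] {ι : Type*} [Fintype ι]

theorem dotProduct_mulVec_self_skew (h2 : (2 : F) ≠ 0) {y : Matrix ι ι F} (hy : yᵀ = -y)
    (a : ι → F) : a ⬝ᵥ y *ᵥ a = 0 := by
  have h := dotProduct_mulVec_skew hy a a
  rw [dotProduct_comm (y *ᵥ a) a] at h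
  have : (2 : F) * (a ⬝ᵥ y *ᵥ a) = 0 := by linear_combination h
  exact (mul_eq_zero.1 this).resolve_left h2

theorem wedge_mul_mul_wedge (h2 : (2 : F) ≠ 0) (u v : ι → F) {s : Matrix ι ι F}
    (hs : sᵀ = -s) : wedge u v * s * wedge u v = (v ⬝ᵥ s *ᵥ u) • wedge u v := by
  have huv : u ⬝ᵥ s *ᵥ v = -(v ⬝ᵥ s *ᵥ u) := by
    rw [dotProduct_mulVec_skew hs, dotProduct_comm]
  have h (a b c d : ι → F) :
      vecMulVec a b * s * vecMulVec c d = (b ⬝ᵥ s *ᵥ c) • vecMulVec a d := by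
    rw [mul_assoc, mul_vecMulVec, vecMulVec_mul_vecMulVec, vecMulVec_smul]
  simp only [wedge, sub_mul, mul_sub, h, dotProduct_mulVec_self_skew h2 hs, huv]
  simp only [zero_smul, neg_smul]
  module

theorem lie_lie_lie_of_sandwich {y : Matrix ι ι F} (hy3 : y * y * y = -y)
    (hys : ∀ s : Matrix ι ι F, sᵀ = -s → ∃ κ : F, y * s * y = κ • y)
    {s : Matrix ι ι F} (hs : sᵀ = -s) : ⁅y, ⁅y, ⁅y, s⁆⁆⁆ = -⁅y, s⁆ := by
  obtain ⟨κ, hκ⟩ := hys s hs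
  have h1 : y * (y * s * y) = (y * s * y) * y := by rw [hκ]; simp
  have h2 : ⁅y, ⁅y, ⁅y, s⁆⁆⁆ = (y * y * y) * s - s * (y * y * y)
      - 3 • (y * (y * s * y) - (y * s * y) * y) := by
    simp only [Ring.lie_def]; noncomm_ring
  rw [h2, h1, hy3, Ring.lie_def]; noncomm_ring

theorem mul_eq_zero_of_commute_of_sandwich {y z : Matrix ι ι F} (hy3 : y * y * y = -y)
    (hz3 : z * z * z = -z) (hyz : y * z = z * y) {κ κ' : F} (hκ : y * z * y = κ • y)
    (hκ' : z * y * z = κ' • z) (hind : ∀ c : F, z ≠ c • y) : y * z = 0 := by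
  have e1 : y * z = -(κ • (y * y)) := by
    have : y * y * y * z = κ • (y * y) := by
      calc y * y * y * z = y * (y * (y * z)) := by simp only [mul_assoc]
        _ = y * (y * z * y) := by rw [mul_assoc y z y, ← hyz]
        _ = _ := by rw [hκ]; simp
    rw [hy3] at this
    rw [← this]; simp
  have e2 : y * z = -(κ' • (z * z)) := by
    have : z * z * z * y = κ' • (z * z) := by
      calc z * z * z * y = z * (z * (z * y)) := by simp only [mul_assoc]
        _ = z * (z * y * z) := by rw [mul_assoc z y z, hyz]
        _ = _ := by rw [hκ']; simp
    rw [hz3] at this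
    rw [hyz, ← this]; simp
  by_cases h0 : κ' = 0
  · rw [e2, h0]; simp
  exfalso
  have e3 : z * z = (κ / κ') • (y * y) := by
    have : κ' • (z * z) = κ • (y * y) := by rw [← neg_inj, ← e1, ← e2]
    rw [div_eq_inv_mul, mul_smul, ← this, smul_smul, inv_mul_cancel₀ h0, one_smul]
  refine hind (-(κ / κ' * κ)) ?_
  calc z = -(z * z * z) := by rw [hz3]; simp
    _ = -((κ / κ') • (y * (y * z))) := by rw [e3]; simp [mul_assoc]
    _ = -((κ / κ') • (y * z * y)) := by rw [hyz]; simp [mul_assoc]; rw [← mul_assoc, hyz, mul_assoc]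
    _ = _ := by rw [hκ, smul_smul, neg_smul]

end skew_triple

section eigen
variable {F : Type*} [Field F] {ι : Type*}

theorem exists_eq_smul_of_wedge_eq_zero {a c : ι → F} (ha : a ≠ 0) (h : wedge a c = 0) :
    ∃ t : F, c = t • a := by
  obtain ⟨p, hp⟩ := Function.ne_iff.1 ha
  refine ⟨c p / a p, funext fun q => ?_⟩
  have := congrFun (congrFun h p) q
  simp only [wedge_apply, Matrix.zero_apply] at this
  simp only [Pi.smul_apply, smul_eq_mul]
  have hp' : a p ≠ 0 := hp
  field_simp
  linear_combination this

variable [Fintype ι]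

theorem finrank_ker_mul_le [DecidableEq ι] (A B : Matrix ι ι F) :
    Module.finrank F (toLin' (A * B)).ker ≤
      Module.finrank F (toLin' A).ker + Module.finrank F (toLin' B).ker := by
  let h : (toLin' (A * B)).ker →ₗ[F] (toLin' A).ker :=
    ((toLin' B).domRestrict _).codRestrict _ fun x => by
      have hx : toLin' (A * B) x.1 = 0 := x.2
      rw [LinearMap.mem_ker, LinearMap.domRestrict_apply, ← LinearMap.comp_apply, ← toLin'_mul, hx]
  have h1 := LinearMap.finrank_range_add_finrank_ker h
  have h2 : Module.finrank F h.ker ≤ Module.finrank F (toLin' B).ker := by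
    let j : h.ker →ₗ[F] (toLin' B).ker :=
      ((Submodule.subtype _).comp (Submodule.subtype _)).codRestrict _
      fun x => congrArg Subtype.val (LinearMap.mem_ker.1 x.2)
    refine LinearMap.finrank_le_finrank_of_injective (f := j) fun x x' hx => ?_
    have := congrArg Subtype.val hx
    exact Subtype.ext (Subtype.ext this)
  have h3 : Module.finrank F h.range ≤ Module.finrank F (toLin' A).ker := Submodule.finrank_le _
  omega

variable [DecidableEq ι]

theorem exists_smul_of_eigenvector {y : Matrix ι ι F} (hy : yᵀ = -y)
    (hcube : ∀ s : Matrix ι ι F, sᵀ = -s → ⁅y, ⁅y, ⁅y, s⁆⁆⁆ = -⁅y, s⁆)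
    {a : ι → F} (ha : a ≠ 0) {l : F} (hl : y *ᵥ a = l • a) (b : ι → F) :
    ∃ t : F, ((y + l • 1) * (y + l • 1) * (y + l • 1) + (y + l • 1)) *ᵥ b = t • a := by
  set N := y + l • (1 : Matrix ι ι F) with hN
  have hw (c : ι → F) : ⁅y, wedge a c⁆ = wedge a (N *ᵥ c) := by
    rw [lie_wedge hy, hl, hN]
    ext i j
    simp only [Matrix.add_apply, wedge_apply, add_mulVec, smul_mulVec, one_mulVec, Pi.add_apply,
      Pi.smul_apply, smul_eq_mul]
    ring
  apply exists_eq_smul_of_wedge_eq_zero ha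
  have := hcube (wedge a b) (transpose_wedge a b)
  rw [hw, hw, hw] at this
  rw [add_mulVec, ← mulVec_mulVec, ← mulVec_mulVec]
  ext i j
  have := congrFun (congrFun this i) j
  simp only [Matrix.zero_apply, Matrix.neg_apply, wedge_apply, Pi.add_apply] at this ⊢
  linear_combination this

theorem exists_two_le_finrank_ker [IsAlgClosed F]
    (hn : 5 ≤ Fintype.card ι) {y : Matrix ι ι F} (hy : yᵀ = -y)
    (hcube : ∀ s : Matrix ι ι F, sᵀ = -s → ⁅y, ⁅y, ⁅y, s⁆⁆⁆ = -⁅y, s⁆) :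
    ∃ m : F, 2 ≤ Module.finrank F (toLin' (y - m • 1)).ker := by
  have : Nonempty ι := Fintype.card_pos_iff.1 (by omega)
  obtain ⟨l, hl⟩ := Module.End.exists_eigenvalue (toLin' y)
  obtain ⟨a, ha⟩ := hl.exists_hasEigenvector
  have hya : y *ᵥ a = l • a := by simpa using ha.apply_eq_smul
  obtain ⟨i, hi⟩ := IsAlgClosed.exists_pow_nat_eq (-1 : F) (n := 2) (by norm_num)
  set N := y + l • (1 : Matrix ι ι F) with hN
  have hprod : N * N * N + N = N * ((N - i • 1) * (N + i • 1)) := by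
    have hi' : (i • (1 : Matrix ι ι F)) * (i • 1) = - 1 := by
      rw [smul_mul_smul_comm, ← sq, hi]; simp
    have : N * i • (1 : Matrix ι ι F) = i • 1 * N := by simp
    clear_value N
    generalize i • (1 : Matrix ι ι F) = I at hi' this
    calc N * N * N + N = N * (N * N + N * I - I * N - I * I) := by
          rw [hi', this]; noncomm_ring
      _ = _ := by noncomm_ring
  have hrange : Module.finrank F (toLin' (N * ((N - i • 1) * (N + i • 1)))).range ≤ 1 := by
    rw [← hprod]
    have hle : (toLin' (N * N * N + N)).range ≤ Submodule.span F {a} := by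
      rintro _ ⟨b, rfl⟩
      obtain ⟨t, ht⟩ := exists_smul_of_eigenvector hy hcube ha.2 hya b
      rw [toLin'_apply, ht]
      exact Submodule.smul_mem _ _ (Submodule.mem_span_singleton_self a)
    refine (Submodule.finrank_mono hle).trans ?_
    rw [finrank_span_singleton ha.2]
  have h1 := LinearMap.finrank_range_add_finrank_ker (toLin' (N * ((N - i • 1) * (N + i • 1))))
  have h3 := finrank_ker_mul_le N ((N - i • 1) * (N + i • 1))
  have h4 := finrank_ker_mul_le (N - i • 1) (N + i • 1)
  rw [Module.finrank_fintype_fun_eq_card] at h1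
  have e1 : N = y - (-l) • 1 := by rw [hN]; module
  have e2 : N - i • 1 = y - (i - l) • 1 := by rw [hN]; module
  have e3 : N + i • 1 = y - (-i - l) • 1 := by rw [hN]; module
  by_contra! hcon
  have c1 := hcon (-l)
  have c2 := hcon (i - l)
  have c3 := hcon (-i - l)
  rw [← e1] at c1
  rw [← e2] at c2
  rw [← e3] at c3
  omega

theorem exists_pair_of_two_le_finrank {V : Type*} [AddCommGroup V] [Module F V]
    {W : Submodule F V} (h : 2 ≤ Module.finrank F W) :
    ∃ a ∈ W, ∃ b ∈ W, a ≠ 0 ∧ ∀ c : F, b ≠ c • a := by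
  have : Nontrivial W := Module.nontrivial_of_finrank_pos (R := F) (by omega)
  obtain ⟨a, ha⟩ := exists_ne (0 : W)
  by_contra! hcon
  have := finrank_le_one a fun w => by
    obtain ⟨c, hc⟩ := hcon a a.2 w w.2 (by simpa using ha)
    exact ⟨c, Subtype.ext hc.symm⟩
  omega

theorem cube_eq_neg_or_four_sq_eq_neg_one [IsAlgClosed F] (h2 : (2 : F) ≠ 0)
    (hn : 5 ≤ Fintype.card ι) {y : Matrix ι ι F} (hy : yᵀ = -y)
    (hcube : ∀ s : Matrix ι ι F, sᵀ = -s → ⁅y, ⁅y, ⁅y, s⁆⁆⁆ = -⁅y, s⁆) :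
    y * y * y = -y ∨ (4 : F) • (y * y) = -1 := by
  obtain ⟨m, hm⟩ := exists_two_le_finrank_ker hn hy hcube
  obtain ⟨a, ha, b, hb, ha0, hab⟩ := exists_pair_of_two_le_finrank hm
  have hb0 : b ≠ 0 := by simpa using hab 0
  have hker {v : ι → F} (hv : v ∈ (toLin' (y - m • 1)).ker) : y *ᵥ v = m • v := by
    simpa [sub_mulVec, smul_mulVec, sub_eq_zero] using hv
  have hP : (y + m • 1) * (y + m • 1) * (y + m • 1) + (y + m • 1) = 0 := by
    refine Matrix.toLin'.injective (LinearMap.ext fun v => ?_)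
    obtain ⟨t, ht⟩ := exists_smul_of_eigenvector hy hcube ha0 (hker ha) v
    obtain ⟨t', ht'⟩ := exists_smul_of_eigenvector hy hcube hb0 (hker hb) v
    rw [toLin'_apply, ht, map_zero, LinearMap.zero_apply]
    by_cases h0 : t' = 0
    · rw [← ht, ht', h0, zero_smul]
    · refine absurd ?_ (hab (t'⁻¹ * t))
      rw [mul_smul, ← ht, ht', smul_smul, inv_mul_cancel₀ h0, one_smul]
  have hPt := congrArg Matrix.transpose hP
  simp only [transpose_add, transpose_mul, transpose_smul, transpose_one, transpose_zero, hy]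
    at hPt
  have hm2 : (2 * m) * ((2 * m) ^ 2 + 1) = 0 := by
    have := congrArg (· *ᵥ a) hP
    simp only [add_mulVec, ← mulVec_mulVec, smul_mulVec, one_mulVec, zero_mulVec, hker ha,
      mulVec_add, mulVec_smul] at this
    have h : ((2 * m) * ((2 * m) ^ 2 + 1)) • a = 0 := by rw [← this]; module
    exact (smul_eq_zero.1 h).resolve_right ha0
  have hadd : y * y * y + (3 * m ^ 2 + 1) • y = 0 := by
    have h : (2 : F) • (y * y * y + (3 * m ^ 2 + 1) • y) = 0 := by
      have := congrArg₂ (· - ·) hP hPt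
      simp only [sub_zero] at this
      rw [← this]
      simp only [mul_add, add_mul, mul_neg, neg_mul, smul_mul_assoc, mul_smul_comm, one_mul, mul_one,
        ← mul_assoc]
      module
    exact (smul_eq_zero.1 h).resolve_left h2
  rcases mul_eq_zero.1 hm2 with h | h
  · left
    have : m = 0 := (mul_eq_zero.1 h).resolve_left h2
    rw [eq_neg_iff_add_eq_zero, ← hadd, this]; simp
  by_cases h3 : (3 : F) = 0
  · left
    rw [eq_neg_iff_add_eq_zero, ← hadd, h3]; simp
  right
  have hm0 : m ≠ 0 := by rintro rfl; simp at h
  have : (2 * m) • ((3 : F) • (y * y) + (m ^ 2 + 1) • (1 : Matrix ι ι F)) = 0 := by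
    have := congrArg₂ (· + ·) hP hPt
    simp only [add_zero] at this
    rw [← this]
    simp only [mul_add, add_mul, mul_neg, neg_mul, smul_mul_assoc, mul_smul_comm, one_mul, mul_one,
        ← mul_assoc]
    module
  have h5 := (smul_eq_zero.1 this).resolve_left (mul_ne_zero h2 hm0)
  have h6 : (3 : F) • ((4 : F) • (y * y) + 1) = 0 := by
    have : (3 : F) • ((4 : F) • (y * y) + 1) = (4 : F) • ((3 : F) • (y * y)
        + (m ^ 2 + 1) • (1 : Matrix ι ι F)) - ((2 * m) ^ 2 + 1) • (1 : Matrix ι ι F) := by module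
    rw [this, h5, h]; simp
  exact eq_neg_of_add_eq_zero_left ((smul_eq_zero.1 h6).resolve_left h3)

end eigen

section root_space
variable {F : Type*} [Field F]

/-- Skew-symmetric matrices with strictly increasing index pairs as coordinates. -/
def skewMatrixEquiv (h2 : (2 : F) ≠ 0) (r : ℕ) :
    skewMatrix F r ≃ₗ[F] ({p : Fin r × Fin r // p.1 < p.2} → F) where
  toFun s p := s.1 p.1.1 p.1.2
  map_add' _ _ := rfl
  map_smul' _ _ := rfl
  invFun f := ⟨Matrix.of fun i j =>
    if h : i < j then f ⟨(i, j), h⟩ else if h : j < i then -f ⟨(j, i), h⟩ else 0, by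
      change _ᵀ = -_
      ext i j
      simp only [transpose_apply, of_apply, Matrix.neg_apply]
      rcases lt_trichotomy i j with h | h | h
      · simp [h, h.not_gt]
      · simp [h]
      · simp [h, h.not_gt]⟩
  left_inv s := by
    have hs : s.1ᵀ = -s.1 := s.2
    have hs' (i j) : s.1 j i = -s.1 i j := congrFun (congrFun hs i) j
    apply Subtype.ext
    ext i j
    rcases lt_trichotomy i j with h | h | h
    · simp [h]
    · subst h
      have : (2 : F) * s.1 i i = 0 := by linear_combination hs' i i
      simpa [h2] using ((mul_eq_zero.1 this).resolve_left h2).symm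
    · simp [h, h.not_gt, ← hs']
  right_inv f := by
    funext p
    simp [p.2]

theorem card_lt_pairs (r : ℕ) :
    2 * Fintype.card {p : Fin r × Fin r // p.1 < p.2} + r = r * r := by
  have h : Fintype.card {p : Fin r × Fin r // p.2 < p.1} =
      Fintype.card {p : Fin r × Fin r // p.1 < p.2} :=
    Fintype.card_congr ((Equiv.prodComm _ _).subtypeEquiv fun p => Iff.rfl)
  have h1 := Fintype.card_subtype_compl (fun p : Fin r × Fin r => p.1 < p.2)
  have h3 : Fintype.card {p : Fin r × Fin r // ¬ p.1 < p.2} =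
      Fintype.card {p : Fin r × Fin r // p.2 < p.1} + r := by
    have e : Fintype.card {p : Fin r × Fin r // p.1 = p.2} = r := by
      conv_rhs => rw [← Fintype.card_fin r]
      exact Fintype.card_congr
        ⟨fun p => p.1.1, fun i => ⟨(i, i), rfl⟩, fun p => Subtype.ext (Prod.ext rfl p.2),
          fun i => rfl⟩
    refine Eq.trans ?_ (congrArg (_ + ·) e)
    refine (Fintype.card_congr (Equiv.subtypeEquivRight fun p => ?_)).trans
      (Fintype.card_subtype_or_disjoint (fun p : Fin r × Fin r => p.2 < p.1)
        (fun p => p.1 = p.2) ?_)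
    · rw [not_lt, le_iff_lt_or_eq, eq_comm (a := p.2)]
    · rw [Pi.disjoint_iff]
      intro p
      simp only [Prop.disjoint_iff, not_and]
      intro hp hp'
      exact absurd hp' hp.ne'
  have h4 := Fintype.card_subtype_le (fun p : Fin r × Fin r => p.1 < p.2)
  rw [Fintype.card_prod, Fintype.card_fin] at h1 h4
  omega

variable {n : ℕ}

/-- The eigenspace of `ad y` on skew-symmetric matrices. -/
def skewRootSpace (y : Matrix (Fin n) (Fin n) F) (l : F) :
    Submodule F (Matrix (Fin n) (Fin n) F) where
  carrier := {s | sᵀ = -s ∧ ⁅y, s⁆ = l • s}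
  add_mem' := by
    rintro a b ⟨ha, ha'⟩ ⟨hb, hb'⟩
    exact ⟨by rw [transpose_add, ha, hb, neg_add], by
      rw [smul_add, ← ha', ← hb']; simp only [Ring.lie_def]; noncomm_ring⟩
  zero_mem' := by simp [Ring.lie_def]
  smul_mem' := by
    rintro c a ⟨ha, ha'⟩
    refine ⟨by rw [transpose_smul, ha, smul_neg], ?_⟩
    simp only [Ring.lie_def] at ha' ⊢
    rw [mul_smul_comm, smul_mul_assoc, ← smul_sub, ha', smul_comm]

theorem mem_skewRootSpace {y s : Matrix (Fin n) (Fin n) F} {l : F} :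
    s ∈ skewRootSpace y l ↔ sᵀ = -s ∧ ⁅y, s⁆ = l • s := Iff.rfl

/-- An idempotent matrix splits through its range. -/
theorem exists_factorization_of_idempotent {p : Matrix (Fin n) (Fin n) F} (hp : p * p = p)
    {r : ℕ} (hr' : p.rank = r) :
    ∃ (A : Matrix (Fin n) (Fin r) F) (C : Matrix (Fin r) (Fin n) F),
      A * C = p ∧ C * A = 1 := by
  let W := (toLin' p).range
  have hr : r = Module.finrank F W := by rw [← hr', Matrix.rank, ← toLin'_apply']
  let b : Module.Basis (Fin r) F W := Module.finBasisOfFinrankEq F W hr.symm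
  let fA : (Fin r → F) →ₗ[F] (Fin n → F) := W.subtype ∘ₗ b.equivFun.symm.toLinearMap
  let fC : (Fin n → F) →ₗ[F] (Fin r → F) := b.equivFun.toLinearMap ∘ₗ (toLin' p).rangeRestrict
  refine ⟨LinearMap.toMatrix' fA, LinearMap.toMatrix' fC, ?_, ?_⟩
  · rw [← LinearMap.toMatrix'_comp]
    have : fA ∘ₗ fC = toLin' p := by
      refine LinearMap.ext fun v => ?_
      simp [fA, fC]
    rw [this, LinearMap.toMatrix'_toLin']
  · rw [← LinearMap.toMatrix'_comp]
    have : fC ∘ₗ fA = LinearMap.id := by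
      refine LinearMap.ext fun v => ?_
      simp only [fA, fC, LinearMap.comp_apply, LinearEquiv.coe_coe, Submodule.subtype_apply,
        LinearMap.id_apply]
      rw [← LinearEquiv.eq_symm_apply]
      apply Subtype.ext
      obtain ⟨w, hw⟩ := (b.equivFun.symm v).2
      rw [← hw]
      change toLin' p (toLin' p w) = toLin' p w
      rw [← LinearMap.comp_apply, ← toLin'_mul, hp]
    rw [this, LinearMap.toMatrix'_id]

theorem mem_skewRootSpace_iff_of_idempotent (h2 : (2 : F) ≠ 0) {y : Matrix (Fin n) (Fin n) F}
    {i : F} (hi : i ^ 2 = -1) {p : Matrix (Fin n) (Fin n) F}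
    (hpp : p * p = p) (hpt : pᵀ = 1 - p) (hy : y = (i / 2) • (p - pᵀ))
    {s : Matrix (Fin n) (Fin n) F} (hs : sᵀ = -s) :
    s ∈ skewRootSpace y i ↔ p * s * pᵀ = s := by
  have hi0 : i ≠ 0 := by rintro rfl; simp at hi
  have hpq : p * pᵀ = 0 := by rw [hpt, mul_sub, hpp]; simp
  have hqp : pᵀ * p = 0 := by rw [hpt, sub_mul, hpp]; simp
  have hqq : pᵀ * pᵀ = pᵀ := by rw [← transpose_mul, hpp]
  have h1 : p + pᵀ = 1 := by rw [hpt]; simp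
  generalize pᵀ = q at *
  have hpq' (m : Matrix (Fin n) (Fin n) F) : p * (q * m) = 0 := by rw [← mul_assoc, hpq, zero_mul]
  have hqp' (m : Matrix (Fin n) (Fin n) F) : q * (p * m) = 0 := by rw [← mul_assoc, hqp, zero_mul]
  have hpp' (m : Matrix (Fin n) (Fin n) F) : p * (p * m) = p * m := by rw [← mul_assoc, hpp]
  have hqq' (m : Matrix (Fin n) (Fin n) F) : q * (q * m) = q * m := by rw [← mul_assoc, hqq]
  rw [mem_skewRootSpace, Ring.lie_def]
  constructor
  · rintro ⟨-, h⟩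
    have hsplit : s = p * s * q + p * s * p + q * s * p + q * s * q := by
      calc s = (p + q) * s * (p + q) := by rw [h1]; simp
        _ = _ := by noncomm_ring
    have a1 : p * s * p = 0 := by
      have := congrArg (fun m => p * m * p) h
      simp only [hy, sub_mul, mul_sub, neg_mul, mul_assoc, smul_mul_assoc, mul_smul_comm, hpp, hqq, hpq, hqp,
        hpp', hqq', hpq', hqp', mul_zero, smul_sub, sub_zero, zero_sub, smul_zero, sub_self] at this
      rw [mul_assoc]
      exact (smul_eq_zero.1 this.symm).resolve_left hi0
    have a2 : q * s * q = 0 := by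
      have := congrArg (fun m => q * m * q) h
      simp only [hy, sub_mul, mul_sub, neg_mul, mul_assoc, smul_mul_assoc, mul_smul_comm, hpp, hqq, hpq, hqp,
        hpp', hqq', hpq', hqp', mul_zero, smul_sub, sub_zero, zero_sub, smul_zero, sub_self] at this
      rw [mul_assoc]
      simpa [hi0, eq_comm] using this
    have a3 : q * s * p = 0 := by
      have := congrArg (fun m => q * m * p) h
      simp only [hy, sub_mul, mul_sub, neg_mul, mul_assoc, smul_mul_assoc, mul_smul_comm, hpp, hqq, hpq, hqp,
        hpp', hqq', hpq', hqp', mul_zero, smul_sub, sub_zero, zero_sub, smul_zero, sub_self] at this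
      rw [mul_assoc]
      have h' : (2 * i) • (q * (s * p)) = 0 := by
        have e : (2 * i) • (q * (s * p)) = i • (q * (s * p)) - (-((i / 2) • (q * (s * p))) - (i / 2) • (q * (s * p))) := by
          match_scalars
          field_simp
          ring
        rw [e, this, sub_self]
      exact (smul_eq_zero.1 h').resolve_left (mul_ne_zero h2 hi0)
    rw [a1, a2, a3] at hsplit
    simpa using hsplit.symm
  · intro h
    refine ⟨hs, ?_⟩
    rw [← h, hy]
    simp only [sub_mul, mul_sub, neg_mul, mul_assoc, smul_mul_assoc, mul_smul_comm, hpp, hqq, hpq, hqp,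
        hpp', hqq', hpq', hqp', mul_zero, smul_sub, sub_zero, zero_sub, smul_zero, sub_self]
    match_scalars
    field_simp
    ring

theorem four_sq_ne_neg_one (h2 : (2 : F) ≠ 0) (hn : 5 ≤ n) (hn8 : n ≠ 8)
    {y : Matrix (Fin n) (Fin n) F} (hy : yᵀ = -y) {i : F} (hi : i ^ 2 = -1)
    (hfin : Module.finrank F (skewRootSpace y i) = n - 2) : (4 : F) • (y * y) ≠ -1 := by
  intro h4
  have hi0 : i ≠ 0 := by rintro rfl; simp at hi
  have h22 : (4 : F) = 2 * 2 := by norm_num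
  set p : Matrix (Fin n) (Fin n) F := (1 / 2 : F) • (1 - (2 * i) • y) with hp
  have hpt' : pᵀ = (1 / 2 : F) • (1 + (2 * i) • y) := by
    rw [hp, transpose_smul, transpose_sub, transpose_smul, hy, transpose_one]; simp
  have hpt : pᵀ = 1 - p := by
    rw [hpt', hp]; match_scalars <;> field_simp <;> ring
  have hpp : p * p = p := by
    have hyy : y * y = (-(1 / 4) : F) • 1 := by
      rw [neg_smul, ← smul_neg, ← h4, smul_smul, h22]; field_simp; simp
    rw [hp]
    simp only [smul_mul_assoc, mul_smul_comm, sub_mul, mul_sub, one_mul, mul_one, hyy]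
    match_scalars
    · rw [h22]; field_simp; linear_combination -hi
    · field_simp; ring
  have hyp : y = (i / 2) • (p - pᵀ) := by
    rw [hpt', hp]; match_scalars
    · field_simp; linear_combination 2 * hi
    · field_simp; ring
  have hrank : 2 * p.rank = n := by
    have e : (toLin' p).ker = (toLin' pᵀ).range := by
      ext v
      simp only [LinearMap.mem_ker, LinearMap.mem_range, toLin'_apply]
      constructor
      · intro h
        exact ⟨v, by rw [hpt, sub_mulVec, h]; simp⟩
      · rintro ⟨w, rfl⟩
        rw [mulVec_mulVec, hpt, mul_sub, hpp]; simp
    have := LinearMap.finrank_range_add_finrank_ker (toLin' p)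
    rw [e, Module.finrank_fintype_fun_eq_card, Fintype.card_fin] at this
    have h1 : p.rank = Module.finrank F (toLin' p).range := by rw [Matrix.rank, ← toLin'_apply']
    have h1' : pᵀ.rank = Module.finrank F (toLin' pᵀ).range := by
      rw [Matrix.rank, ← toLin'_apply']
    rw [rank_transpose] at h1'
    omega
  obtain ⟨r, hr⟩ : ∃ r, p.rank = r := ⟨_, rfl⟩
  obtain ⟨A, C, hAC, hCA⟩ := exists_factorization_of_idempotent hpp hr
  have hAC' : Cᵀ * Aᵀ = pᵀ := by rw [← transpose_mul, hAC]
  have hCA' : Aᵀ * Cᵀ = 1 := by rw [← transpose_mul, hCA, transpose_one]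
  let e : skewRootSpace y i ≃ₗ[F] skewMatrix F r :=
    { toFun := fun s => ⟨C * s.1 * Cᵀ, by
        change _ᵀ = -_
        have := s.2.1
        simp only [transpose_mul, transpose_transpose, this]
        simp [Matrix.mul_assoc]⟩
      map_add' := fun s t => by
        apply Subtype.ext
        simp [Matrix.mul_add, Matrix.add_mul]
      map_smul' := fun c s => by
        apply Subtype.ext
        simp
      invFun := fun t => ⟨A * t.1 * Aᵀ, by
        have ht : t.1ᵀ = -t.1 := t.2
        rw [mem_skewRootSpace_iff_of_idempotent h2 hi hpp hpt hyp]
        · rw [← hAC', ← hAC]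
          calc A * C * (A * t.1 * Aᵀ) * (Cᵀ * Aᵀ) = A * (C * A) * t.1 * ((Aᵀ * Cᵀ) * Aᵀ) := by
                simp only [Matrix.mul_assoc]
            _ = _ := by rw [hCA, hCA']; simp
        · simp only [transpose_mul, transpose_transpose, ht]
          simp [Matrix.mul_assoc]⟩
      left_inv := fun s => by
        apply Subtype.ext
        change A * (C * s.1 * Cᵀ) * Aᵀ = s.1
        have := (mem_skewRootSpace_iff_of_idempotent h2 hi hpp hpt hyp s.2.1).1 s.2
        conv_rhs => rw [← this, ← hAC', ← hAC]
        simp only [Matrix.mul_assoc]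
      right_inv := fun t => by
        apply Subtype.ext
        change C * (A * t.1 * Aᵀ) * Cᵀ = t.1
        calc C * (A * t.1 * Aᵀ) * Cᵀ = (C * A) * t.1 * (Aᵀ * Cᵀ) := by
              simp only [Matrix.mul_assoc]
          _ = _ := by rw [hCA, hCA']; simp }
  have hd := (e.trans (skewMatrixEquiv h2 _)).finrank_eq
  rw [hfin, Module.finrank_fintype_fun_eq_card] at hd
  have hc := card_lt_pairs r
  rw [hr] at hrank
  have h' : 2 * (n - 2) + r = r * r := by rw [hd]; exact hc
  have hr4 : r ≤ 4 := by
    by_contra! hcon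
    have : 5 * r ≤ r * r := Nat.mul_le_mul_right _ hcon
    omega
  clear e hd hc A C hAC hCA hAC' hCA' hr
  interval_cases r <;> omega

end root_space

section elemSkew
variable {R : Type*} [CommRing R] {n : ℕ}

/-- The skew-symmetric matrix `E_kl - E_lk`. -/
def elemSkew (R : Type*) [CommRing R] {n : ℕ} (k l : Fin n) : Matrix (Fin n) (Fin n) R :=
  wedge (Pi.single k 1) (Pi.single l 1)

theorem transpose_elemSkew (k l : Fin n) : (elemSkew R k l)ᵀ = -elemSkew R k l :=
  transpose_wedge _ _

theorem elemSkew_comm (k l : Fin n) : elemSkew R k l = -elemSkew R l k := by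
  simp [elemSkew, wedge]

theorem elemSkew_self (k : Fin n) : elemSkew R k k = 0 := by
  simp [elemSkew, wedge]

theorem elemSkew_mul_apply (k l : Fin n) (s : Matrix (Fin n) (Fin n) R) (p q : Fin n) :
    (elemSkew R k l * s) p q =
      (Pi.single k 1 : Fin n → R) p * s l q - (Pi.single l 1 : Fin n → R) p * s k q := by
  simp only [elemSkew, wedge, sub_mul, vecMulVec_mul, single_one_vecMul]
  rfl

theorem mul_elemSkew_apply (k l : Fin n) (s : Matrix (Fin n) (Fin n) R) (p q : Fin n) :
    (s * elemSkew R k l) p q =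
      s p k * (Pi.single l 1 : Fin n → R) q - s p l * (Pi.single k 1 : Fin n → R) q := by
  simp only [elemSkew, wedge, mul_sub, mul_vecMulVec, mulVec_single_one]
  rfl

theorem elemSkew_mulVec (k l : Fin n) (v : Fin n → R) :
    elemSkew R k l *ᵥ v = v l • Pi.single k 1 - v k • Pi.single l 1 := by
  simp only [elemSkew, wedge, sub_mulVec, vecMulVec_mulVec, single_one_dotProduct]
  simp

theorem elemSkew_mul_elemSkew {i j k : Fin n} (hij : i ≠ j) (hjk : j ≠ k) (hik : i ≠ k) :
    elemSkew R i j * elemSkew R j k = vecMulVec (Pi.single i 1) (Pi.single k 1) := by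
  ext p q
  rw [elemSkew_mul_apply]
  simp [elemSkew, wedge_apply, vecMulVec_apply, hij, hjk, hik, hij.symm, hjk.symm, hik.symm]

theorem elemSkew_mul_elemSkew_of_disjoint {i j k l : Fin n} (hik : i ≠ k) (hil : i ≠ l)
    (hjk : j ≠ k) (hjl : j ≠ l) : elemSkew R i j * elemSkew R k l = 0 := by
  ext p q
  rw [elemSkew_mul_apply]
  simp [elemSkew, wedge_apply, hik, hjk, hil, hjl, hil.symm, hjk.symm, hik.symm, hjl.symm]

theorem lie_elemSkew {i j k : Fin n} (hij : i ≠ j) (hjk : j ≠ k) (hik : i ≠ k) :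
    ⁅elemSkew R i j, elemSkew R j k⁆ = elemSkew R i k := by
  rw [Ring.lie_def, elemSkew_mul_elemSkew hij hjk hik, elemSkew_comm j k, elemSkew_comm i j,
    neg_mul_neg, elemSkew_mul_elemSkew hjk.symm hij.symm hik.symm]
  rfl

theorem lie_elemSkew_of_disjoint {i j k l : Fin n} (hik : i ≠ k) (hil : i ≠ l)
    (hjk : j ≠ k) (hjl : j ≠ l) : ⁅elemSkew R i j, elemSkew R k l⁆ = 0 := by
  rw [Ring.lie_def, elemSkew_mul_elemSkew_of_disjoint hik hil hjk hjl,
    elemSkew_mul_elemSkew_of_disjoint hik.symm hjk.symm hil.symm hjl.symm, sub_zero]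

theorem two_smul_eq_sum_elemSkew {s : Matrix (Fin n) (Fin n) R} (hs : sᵀ = -s) :
    (2 : R) • s = ∑ k, ∑ l, s k l • elemSkew R k l := by
  have hs' (i j) : s j i = -s i j := congrFun (congrFun hs i) j
  ext p q
  simp only [Matrix.sum_apply, Matrix.smul_apply, elemSkew, wedge_apply, smul_eq_mul,
    Pi.single_apply, mul_sub, Finset.sum_sub_distrib]
  simp [hs' p q, two_mul]

theorem elemSkew_cube {k l : Fin n} (h : k ≠ l) :
    elemSkew R k l * elemSkew R k l * elemSkew R k l = -elemSkew R k l := by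
  ext p q
  rw [mul_assoc, elemSkew_mul_apply, elemSkew_mul_apply, elemSkew_mul_apply]
  simp [h, h.symm, elemSkew, wedge_apply]
  ring

theorem elemSkew_ne_zero [Nontrivial R] {k l : Fin n} (h : k ≠ l) : elemSkew R k l ≠ 0 := by
  intro h0
  have := congrFun (congrFun h0 k) l
  simp [elemSkew, wedge_apply, h] at this

end elemSkew

section elemSkew_field
variable {F : Type*} [Field F] {n : ℕ}

theorem lie_lie_lie_elemSkew (h2 : (2 : F) ≠ 0) {k l : Fin n} (h : k ≠ l)
    {s : Matrix (Fin n) (Fin n) F} (hs : sᵀ = -s) :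
    ⁅elemSkew F k l, ⁅elemSkew F k l, ⁅elemSkew F k l, s⁆⁆⁆ = -⁅elemSkew F k l, s⁆ :=
  lie_lie_lie_of_sandwich (elemSkew_cube h) (fun _ ht => ⟨_, wedge_mul_mul_wedge h2 _ _ ht⟩) hs

theorem skew_diag (h2 : (2 : F) ≠ 0) {s : Matrix (Fin n) (Fin n) F} (hs : sᵀ = -s) (k : Fin n) :
    s k k = 0 := by
  have h := congrFun (congrFun hs k) k
  rw [transpose_apply, Matrix.neg_apply] at h
  have : (2 : F) * s k k = 0 := by linear_combination h
  exact (mul_eq_zero.1 this).resolve_left h2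

theorem eq_wedge_of_mem_skewRootSpace (h2 : (2 : F) ≠ 0) {k l : Fin n} (h : k ≠ l) {i : F}
    (hi : i ^ 2 = -1) {s : Matrix (Fin n) (Fin n) F}
    (hs : s ∈ skewRootSpace (elemSkew F k l) i) :
    s = wedge (Pi.single k 1 + i • Pi.single l 1) (s k) ∧ s k l = 0 ∧ s k k = 0 := by
  obtain ⟨hs, hb⟩ := hs
  have hi0 : i ≠ 0 := by rintro rfl; simp at hi
  have hs' (i j) : s j i = -s i j := congrFun (congrFun hs i) j
  have hd := skew_diag h2 hs
  have key (p q) : ((Pi.single k 1 : Fin n → F) p * s l q - (Pi.single l 1 : Fin n → F) p * s k q)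
      - (s p k * (Pi.single l 1 : Fin n → F) q - s p l * (Pi.single k 1 : Fin n → F) q)
      = i * s p q := by
    rw [← elemSkew_mul_apply, ← mul_elemSkew_apply, ← Matrix.sub_apply, ← Ring.lie_def, hb]
    rfl
  have hkl : s k l = 0 := by
    have := key k l
    simp [h, h.symm, hd] at this
    exact this.resolve_left hi0
  have hrow (q) (hqk : q ≠ k) (hql : q ≠ l) : s l q = i * s k q := by
    simpa [h, hqk, hql] using key k q
  have hout (p q) (hpk : p ≠ k) (hpl : p ≠ l) (hqk : q ≠ k) (hql : q ≠ l) : s p q = 0 := by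
    have := key p q
    simpa [hpk, hpl, hqk, hql, hi0, eq_comm] using this
  refine ⟨?_, hkl, hd k⟩
  ext p q
  rw [wedge_apply]
  simp only [Pi.add_apply, Pi.smul_apply, smul_eq_mul]
  by_cases hpk : p = k
  · subst hpk
    simp [h, hd]
  by_cases hpl : p = l
  · subst hpl
    by_cases hqk : q = k
    · subst hqk
      simp [h, h.symm, hd, hkl, hs' q p]
    by_cases hqp : q = p
    · subst hqp
      simp [hd, hkl]
    simp [hqk, hqp, hkl, hrow q hqk hqp, hpk]
  by_cases hqk : q = k
  · subst hqk
    simp [hpk, hpl, h, hs' q p]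
  by_cases hql : q = l
  · subst hql
    simp only [hs' q p, hrow p hpk hpl]
    simp [hpk, hpl, h.symm, mul_comm]
  simp [hpk, hpl, hqk, hql, hout]

theorem lie_eq_zero_of_mem_skewRootSpace (h2 : (2 : F) ≠ 0) {k l : Fin n} (h : k ≠ l) {i : F}
    (hi : i ^ 2 = -1) {s t : Matrix (Fin n) (Fin n) F}
    (hs : s ∈ skewRootSpace (elemSkew F k l) i) (ht : t ∈ skewRootSpace (elemSkew F k l) i) :
    ⁅s, t⁆ = 0 := by
  obtain ⟨h1, h1l, h1k⟩ := eq_wedge_of_mem_skewRootSpace h2 h hi hs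
  obtain ⟨h1', h1l', h1k'⟩ := eq_wedge_of_mem_skewRootSpace h2 h hi ht
  generalize s k = v at *
  generalize t k = w at *
  have hff : (Pi.single k 1 + i • Pi.single l 1 : Fin n → F) ⬝ᵥ
      (Pi.single k 1 + i • Pi.single l 1) = 0 := by
    simp [add_dotProduct, smul_dotProduct, h, h.symm]
    linear_combination hi
  have hfv : (Pi.single k 1 + i • Pi.single l 1 : Fin n → F) ⬝ᵥ v = 0 := by
    simp [add_dotProduct, smul_dotProduct, h1l, h1k]
  have hfw : (Pi.single k 1 + i • Pi.single l 1 : Fin n → F) ⬝ᵥ w = 0 := by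
    simp [add_dotProduct, smul_dotProduct, h1l', h1k']
  have hvf := hfv
  have hwf := hfw
  rw [dotProduct_comm] at hvf hwf
  subst h1 h1'
  simp only [Ring.lie_def, wedge, sub_mul, mul_sub, vecMulVec_mul_vecMulVec, hff, hfv, hfw, hvf,
    hwf, dotProduct_comm w v, zero_smul, vecMulVec_zero]
  abel

theorem wedge_mem_skewRootSpace {k l : Fin n} (h : k ≠ l) {i : F} (hi : i ^ 2 = -1)
    {v : Fin n → F} (hk : v k = 0) (hl : v l = 0) :
    wedge (Pi.single k 1 + i • Pi.single l 1) v ∈ skewRootSpace (elemSkew F k l) i := by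
  refine ⟨transpose_wedge _ _, ?_⟩
  rw [lie_wedge (transpose_elemSkew k l), elemSkew_mulVec, elemSkew_mulVec, hk, hl]
  ext p q
  simp only [Matrix.add_apply, Matrix.smul_apply, wedge_apply, Pi.add_apply, Pi.sub_apply,
    Pi.smul_apply, smul_eq_mul]
  simp [h, h.symm]
  linear_combination (-(Pi.single l 1 : Fin n → F) p * v q
    + (Pi.single l 1 : Fin n → F) q * v p) * hi

theorem finrank_skewRootSpace_elemSkew (h2 : (2 : F) ≠ 0) {k l : Fin n} (h : k ≠ l) {i : F}
    (hi : i ^ 2 = -1) : Module.finrank F (skewRootSpace (elemSkew F k l) i) = n - 2 := by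
  classical
  let e : skewRootSpace (elemSkew F k l) i ≃ₗ[F] ({q : Fin n // ¬ (q = k ∨ q = l)} → F) :=
    { toFun := fun s q => s.1 k q
      map_add' := fun _ _ => rfl
      map_smul' := fun _ _ => rfl
      invFun := fun v => ⟨wedge (Pi.single k 1 + i • Pi.single l 1)
          (fun q => if hq : ¬ (q = k ∨ q = l) then v ⟨q, hq⟩ else 0),
        wedge_mem_skewRootSpace h hi (by simp) (by simp)⟩
      left_inv := fun s => by
        obtain ⟨h1, h1l, h1k⟩ := eq_wedge_of_mem_skewRootSpace h2 h hi s.2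
        apply Subtype.ext
        conv_rhs => rw [h1]
        change wedge _ _ = wedge _ _
        congr 1
        funext q
        by_cases hq : ¬ (q = k ∨ q = l)
        · rw [dif_pos hq]
        · rw [dif_neg hq]
          rcases not_not.1 hq with rfl | rfl
          · exact h1k.symm
          · exact h1l.symm
      right_inv := fun v => by
        funext q
        have := q.2
        rw [not_or] at this
        simp [wedge_apply, h, this.1, this.2] }
  rw [e.finrank_eq, Module.finrank_fintype_fun_eq_card, Fintype.card_subtype_compl,
    Fintype.card_fin, Fintype.card_subtype_or_disjoint]
  · simp
  · rw [Pi.disjoint_iff]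
    intro p
    simp only [Prop.disjoint_iff, not_and]
    rintro rfl
    exact h

end elemSkew_field

section wedge_characterization
variable {F : Type*} [Field F] {n : ℕ}

theorem sq_eq_neg_one_false [IsAlgClosed F] (h2 : (2 : F) ≠ 0) (hn : 5 ≤ n) (hn8 : n ≠ 8)
    {y : Matrix (Fin n) (Fin n) F} (hy : yᵀ = -y)
    (hcube : ∀ s : Matrix (Fin n) (Fin n) F, sᵀ = -s → ⁅y, ⁅y, ⁅y, s⁆⁆⁆ = -⁅y, s⁆)
    {i : F} (hi : i ^ 2 = -1) (hfin : Module.finrank F (skewRootSpace y i) = n - 2)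
    (hyy : y * y = -1) : False := by
  have hi0 : i ≠ 0 := by rintro rfl; simp at hi
  by_cases h3 : (3 : F) = 0
  · refine four_sq_ne_neg_one h2 hn hn8 hy hi hfin ?_
    rw [show (4 : F) = 1 by linear_combination h3, one_smul, hyy]
  have hcomm (s : Matrix (Fin n) (Fin n) F) (hs : sᵀ = -s) : ⁅y, s⁆ = 0 := by
    have e : ⁅y, ⁅y, ⁅y, s⁆⁆⁆ = y * y * (y * s) - (3 : ℕ) • ((y * y) * s * y)
        + (3 : ℕ) • (y * s * (y * y)) - s * y * (y * y) := by
      simp only [Ring.lie_def]; noncomm_ring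
    have h := hcube s hs
    rw [e, hyy] at h
    have h' : (3 : F) • ⁅y, s⁆ = 0 := by
      have e' : (3 : F) • ⁅y, s⁆ = (3 : ℕ) • ⁅y, s⁆ := by
        rw [← Nat.cast_smul_eq_nsmul F]; norm_num
      rw [e']
      calc (3 : ℕ) • ⁅y, s⁆ = -⁅y, s⁆ - (-1 * (y * s) - 3 • (-1 * s * y) + 3 • (y * s * -1)
          - s * y * -1) := by simp only [Ring.lie_def]; noncomm_ring
        _ = 0 := by rw [h, sub_self]
    exact (smul_eq_zero.1 h').resolve_left h3
  have : skewRootSpace y i = ⊥ := by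
    rw [eq_bot_iff]
    rintro s ⟨hs, hs'⟩
    rw [hcomm s hs] at hs'
    exact (smul_eq_zero.1 hs'.symm).resolve_left hi0
  rw [this, finrank_bot] at hfin
  omega

theorem wedge_eq_zero_of_eigenvectors (h2 : (2 : F) ≠ 0) {y : Matrix (Fin n) (Fin n) F}
    (hy : yᵀ = -y) {i : F} (hi : i ^ 2 = -1) (hy3 : y * y * y = -y)
    (habel : ∀ s ∈ skewRootSpace y i, ∀ t ∈ skewRootSpace y i, ⁅s, t⁆ = 0)
    {w : Fin n → F} (hw : w ≠ 0) (hyw : y *ᵥ w = 0) {a b : Fin n → F}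
    (ha : y *ᵥ a = i • a) (hb : y *ᵥ b = i • b) : wedge a b = 0 := by
  have hi0 : i ≠ 0 := by rintro rfl; simp at hi
  obtain ⟨p, hp⟩ := Function.ne_iff.1 hw
  have hp : w p ≠ 0 := hp
  have hy3v (v : Fin n → F) : y *ᵥ y *ᵥ y *ᵥ v = - y *ᵥ v := by
    rw [mulVec_mulVec, mulVec_mulVec, hy3]
  set v : Fin n → F := Pi.single p 1 + y *ᵥ y *ᵥ Pi.single p 1 with hv
  have hyv : y *ᵥ v = 0 := by rw [hv, mulVec_add, hy3v, neg_mulVec, add_neg_cancel]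
  have hvw : v ⬝ᵥ w = w p := by
    rw [hv, add_dotProduct, single_one_dotProduct, dotProduct_comm (y *ᵥ _),
      dotProduct_mulVec_skew hy, hyw]
    simp
  have hab : a ⬝ᵥ b = 0 := by
    have := dotProduct_mulVec_skew hy a b
    rw [ha, hb] at this
    simp only [dotProduct_smul, smul_dotProduct, smul_eq_mul] at this
    have h' : (2 * i) * (a ⬝ᵥ b) = 0 := by linear_combination this
    exact (mul_eq_zero.1 h').resolve_left (mul_ne_zero h2 hi0)
  have hortho {c u : Fin n → F} (hc : y *ᵥ c = i • c) (hu : y *ᵥ u = 0) : c ⬝ᵥ u = 0 := by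
    have := dotProduct_mulVec_skew hy c u
    rw [hc, hu] at this
    simpa [hi0] using this
  have hmem {c u : Fin n → F} (hc : y *ᵥ c = i • c) (hu : y *ᵥ u = 0) :
      wedge c u ∈ skewRootSpace y i := by
    refine ⟨transpose_wedge _ _, ?_⟩
    rw [lie_wedge hy, hc, hu]
    simp [wedge, smul_sub]
  have hlie := habel _ (hmem ha hyv) _ (hmem hb hyw)
  have hav := hortho ha hyv
  have haw := hortho ha hyw
  have hbv := hortho hb hyv
  have hbw := hortho hb hyw
  have hsmul : (w p) • wedge a b = -⁅wedge a v, wedge b w⁆ := by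
    simp only [Ring.lie_def, wedge, sub_mul, mul_sub, vecMulVec_mul_vecMulVec, hab, hav, haw,
      dotProduct_comm v b, dotProduct_comm w a, dotProduct_comm b a, hbv, hbw, hvw,
      dotProduct_comm w v, zero_smul, vecMulVec_zero, vecMulVec_smul]
    module
  rw [hlie, neg_zero] at hsmul
  exact (smul_eq_zero.1 hsmul).resolve_left hp

theorem exists_eq_wedge [IsAlgClosed F] (h2 : (2 : F) ≠ 0) (hn : 5 ≤ n) (hn8 : n ≠ 8)
    {y : Matrix (Fin n) (Fin n) F} (hy : yᵀ = -y)
    (hcube : ∀ s : Matrix (Fin n) (Fin n) F, sᵀ = -s → ⁅y, ⁅y, ⁅y, s⁆⁆⁆ = -⁅y, s⁆)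
    (hfin : ∀ i : F, i ^ 2 = -1 → Module.finrank F (skewRootSpace y i) = n - 2)
    (habel : ∀ i : F, i ^ 2 = -1 →
      ∀ s ∈ skewRootSpace y i, ∀ t ∈ skewRootSpace y i, ⁅s, t⁆ = 0) :
    y * y * y = -y ∧ ∃ a b : Fin n → F, y = wedge a b := by
  obtain ⟨i, hi⟩ := IsAlgClosed.exists_pow_nat_eq (-1 : F) (n := 2) (by norm_num)
  have hi0 : i ≠ 0 := by rintro rfl; simp at hi
  have hy3 : y * y * y = -y :=
    (cube_eq_neg_or_four_sq_eq_neg_one h2 (by simpa using hn) hy hcube).resolve_right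
      (four_sq_ne_neg_one h2 hn hn8 hy hi (hfin i hi))
  refine ⟨hy3, ?_⟩
  obtain ⟨w, hw, hyw⟩ : ∃ w : Fin n → F, w ≠ 0 ∧ y *ᵥ w = 0 := by
    by_contra! hcon
    refine sq_eq_neg_one_false h2 hn hn8 hy hcube hi (hfin i hi) ?_
    refine Matrix.toLin'.injective (LinearMap.ext fun v => ?_)
    by_contra hne
    refine hcon ((y * y + 1) *ᵥ v) (fun h0 => hne ?_) ?_
    · rw [add_mulVec, one_mulVec] at h0
      simpa using eq_neg_of_add_eq_zero_left h0
    · rw [mulVec_mulVec, mul_add, ← mul_assoc, hy3]; simp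
  set p : Matrix (Fin n) (Fin n) F := (-(1 / 2) : F) • (y * y + i • y) with hp
  have hyp : y * p = i • p := by
    rw [hp, mul_smul_comm, mul_add, ← mul_assoc, hy3, mul_smul_comm]
    match_scalars
    · field_simp; linear_combination hi
    · field_simp
  have hdiff : y = i • (p - pᵀ) := by
    rw [hp, transpose_smul, transpose_add, transpose_smul, transpose_mul, hy]
    simp only [neg_mul_neg]
    match_scalars
    · field_simp; linear_combination 2 * hi
    · ring
  have hcol (q : Fin n) : y *ᵥ p.col q = i • p.col q := by
    funext r
    exact congrFun (congrFun hyp r) q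
  by_cases hp0 : p = 0
  · refine ⟨0, 0, ?_⟩
    rw [hdiff, hp0]; simp [wedge]
  obtain ⟨q, hq⟩ : ∃ q, p.col q ≠ 0 := by
    by_contra! hcon
    exact hp0 (by ext r c; exact congrFun (hcon c) r)
  have hex (c : Fin n) : ∃ t : F, p.col c = t • p.col q :=
    exists_eq_smul_of_wedge_eq_zero hq
      (wedge_eq_zero_of_eigenvectors h2 hy hi hy3 (habel i hi) hw hyw (hcol q) (hcol c))
  choose t ht using hex
  refine ⟨i • p.col q, t, ?_⟩
  have hpt : p = vecMulVec (p.col q) t := by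
    ext r c
    have := congrFun (ht c) r
    rw [vecMulVec_apply, mul_comm]
    exact this
  rw [hdiff]
  conv_lhs => rw [hpt]
  simp [wedge, transpose_vecMulVec, smul_sub]

end wedge_characterization

section lie_automorphism
variable {F : Type*} [Field F] {n : ℕ}

/-- A linear map inducing an injective Lie algebra endomorphism of the skew-symmetric matrices. -/
structure IsSkewLieAut (φ : Matrix (Fin n) (Fin n) F →ₗ[F] Matrix (Fin n) (Fin n) F) : Prop where
  skew : ∀ x, xᵀ = -x → (φ x)ᵀ = -φ x
  lie : ∀ x y, xᵀ = -x → yᵀ = -y → φ ⁅x, y⁆ = ⁅φ x, φ y⁆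
  inj : ∀ x, xᵀ = -x → φ x = 0 → x = 0

namespace IsSkewLieAut
variable {φ : Matrix (Fin n) (Fin n) F →ₗ[F] Matrix (Fin n) (Fin n) F}

theorem surj (h : IsSkewLieAut φ) (s : Matrix (Fin n) (Fin n) F) (hs : sᵀ = -s) :
    ∃ x, xᵀ = -x ∧ φ x = s := by
  let f : skewMatrix F n →ₗ[F] skewMatrix F n := φ.restrict fun x hx => h.skew x hx
  have hf : Function.Injective f := by
    rw [injective_iff_map_eq_zero]
    rintro ⟨x, hx⟩ h0
    exact Subtype.ext (h.inj x hx (congrArg Subtype.val h0))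
  obtain ⟨⟨x, hx⟩, hxs⟩ := (LinearMap.injective_iff_surjective.1 hf) ⟨s, hs⟩
  exact ⟨x, hx, congrArg Subtype.val hxs⟩

theorem mem_skewRootSpace_iff (h : IsSkewLieAut φ) {x s : Matrix (Fin n) (Fin n) F} (hx : xᵀ = -x)
    (hs : sᵀ = -s) (l : F) : φ s ∈ skewRootSpace (φ x) l ↔ s ∈ skewRootSpace x l := by
  rw [mem_skewRootSpace, mem_skewRootSpace, ← h.lie x s hx hs, ← φ.map_smul]
  refine and_congr (iff_of_true (h.skew s hs) hs) ⟨fun h' => ?_, fun h' => by rw [h']⟩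
  rw [← sub_eq_zero] at h' ⊢
  rw [← map_sub] at h'
  refine h.inj _ ?_ h'
  rw [transpose_sub, lie_transpose_skew hx hs, transpose_smul, hs]
  simp [sub_eq_add_neg, add_comm]

theorem finrank_skewRootSpace (h : IsSkewLieAut φ) {x : Matrix (Fin n) (Fin n) F} (hx : xᵀ = -x)
    (l : F) :
    Module.finrank F (skewRootSpace (φ x) l) = Module.finrank F (skewRootSpace x l) := by
  let f : skewRootSpace x l →ₗ[F] skewRootSpace (φ x) l :=
    φ.restrict fun s hs => (h.mem_skewRootSpace_iff hx hs.1 l).2 hs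
  refine (LinearEquiv.finrank_eq (LinearEquiv.ofBijective f ⟨?_, ?_⟩)).symm
  · rw [injective_iff_map_eq_zero]
    rintro ⟨s, hs⟩ h0
    exact Subtype.ext (h.inj s hs.1 (congrArg Subtype.val h0))
  · rintro ⟨t, ht⟩
    obtain ⟨s, hs, rfl⟩ := h.surj t ht.1
    exact ⟨⟨s, (h.mem_skewRootSpace_iff hx hs l).1 ht⟩, rfl⟩

variable [IsAlgClosed F]

theorem elemSkew_spec (h : IsSkewLieAut φ) (h2 : (2 : F) ≠ 0) (hn : 5 ≤ n) (hn8 : n ≠ 8)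
    {k l : Fin n} (hkl : k ≠ l) :
    φ (elemSkew F k l) * φ (elemSkew F k l) * φ (elemSkew F k l) = -φ (elemSkew F k l) ∧
      ∃ a b : Fin n → F, φ (elemSkew F k l) = wedge a b := by
  have hX := transpose_elemSkew (R := F) k l
  refine exists_eq_wedge h2 hn hn8 (h.skew _ hX) (fun s hs => ?_) (fun i hi => ?_)
    (fun i hi s hs t ht => ?_)
  · obtain ⟨x, hx, rfl⟩ := h.surj s hs
    have l1 := lie_transpose_skew hX hx
    have l2 := lie_transpose_skew hX l1
    rw [← h.lie _ _ hX hx, ← h.lie _ _ hX l1, ← h.lie _ _ hX l2, lie_lie_lie_elemSkew h2 hkl hx,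
      map_neg]
  · rw [h.finrank_skewRootSpace hX, finrank_skewRootSpace_elemSkew h2 hkl hi]
  · obtain ⟨x, hx, rfl⟩ := h.surj s hs.1
    obtain ⟨z, hz, rfl⟩ := h.surj t ht.1
    rw [h.mem_skewRootSpace_iff hX hx] at hs
    rw [h.mem_skewRootSpace_iff hX hz] at ht
    rw [← h.lie _ _ hx hz, lie_eq_zero_of_mem_skewRootSpace h2 hkl hi hs ht, map_zero]

theorem mul_eq_zero_of_disjoint (h : IsSkewLieAut φ) (h2 : (2 : F) ≠ 0) (hn : 5 ≤ n) (hn8 : n ≠ 8)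
    {i j k l : Fin n} (hij : i ≠ j) (hkl : k ≠ l) (hik : i ≠ k) (hil : i ≠ l) (hjk : j ≠ k)
    (hjl : j ≠ l) : φ (elemSkew F i j) * φ (elemSkew F k l) = 0 := by
  have hX := transpose_elemSkew (R := F) i j
  have hX' := transpose_elemSkew (R := F) k l
  obtain ⟨hy3, a, b, hab⟩ := h.elemSkew_spec h2 hn hn8 hij
  obtain ⟨hz3, c, d, hcd⟩ := h.elemSkew_spec h2 hn hn8 hkl
  have hκ := wedge_mul_mul_wedge h2 a b (h.skew _ hX')
  have hκ' := wedge_mul_mul_wedge h2 c d (h.skew _ hX)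
  rw [← hab] at hκ
  rw [← hcd] at hκ'
  refine mul_eq_zero_of_commute_of_sandwich hy3 hz3 ?_ hκ hκ' fun c hc => ?_
  · rw [← sub_eq_zero, ← Ring.lie_def, ← h.lie _ _ hX hX',
      lie_elemSkew_of_disjoint hik hil hjk hjl, map_zero]
  · rw [← sub_eq_zero, ← φ.map_smul, ← map_sub] at hc
    have := h.inj _ (by rw [transpose_sub, transpose_smul, hX, hX']; simp; abel) hc
    have := congrFun (congrFun this k) l
    simp [elemSkew, wedge_apply, hkl, hik.symm, hjk.symm] at this

end IsSkewLieAut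

end lie_automorphism

section frame
variable {F : Type*} [Field F] {n : ℕ}

theorem exists_notMem_of_length_lt (s : List (Fin n)) (h : s.length < n) : ∃ i, i ∉ s := by
  classical
  by_contra! hcon
  have : (Finset.univ : Finset (Fin n)) ⊆ s.toFinset := fun i _ => by simpa using hcon i
  have := (Finset.card_le_card this).trans s.toFinset_card_le
  simp at this
  omega

theorem eq_zero_of_elemSkew_mulVec {z : Fin n → F} (hn : 2 ≤ n)
    (h : ∀ k l : Fin n, k ≠ l → elemSkew F k l *ᵥ z = 0) : z = 0 := by
  funext l
  obtain ⟨k, hk⟩ := exists_notMem_of_length_lt [l] (by simp; omega)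
  have hk : k ≠ l := by simpa using hk
  have := congrFun (h k l hk) k
  rw [elemSkew_mulVec] at this
  simpa [hk] using this

namespace IsSkewLieAut
variable {φ : Matrix (Fin n) (Fin n) F →ₗ[F] Matrix (Fin n) (Fin n) F}

theorem mul_eq_mul_of_elemSkew (h2 : (2 : F) ≠ 0) {g : Matrix (Fin n) (Fin n) F}
    (hg : ∀ k l : Fin n, k ≠ l → φ (elemSkew F k l) * g = g * elemSkew F k l)
    {x : Matrix (Fin n) (Fin n) F} (hx : xᵀ = -x) : φ x * g = g * x := by
  have hg' (k l : Fin n) : φ (elemSkew F k l) * g = g * elemSkew F k l := by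
    by_cases h : k = l
    · subst h; simp [elemSkew_self]
    · exact hg k l h
  have hx' : x = (2 : F)⁻¹ • ∑ k, ∑ l, x k l • elemSkew F k l := by
    rw [← two_smul_eq_sum_elemSkew hx, smul_smul, inv_mul_cancel₀ h2, one_smul]
  rw [hx']
  simp only [map_smul, map_sum, smul_mul_assoc, mul_smul_comm, Finset.sum_mul, Finset.mul_sum, hg']

variable [IsAlgClosed F]

theorem exists_intertwiner (h : IsSkewLieAut φ) (h2 : (2 : F) ≠ 0) (hn : 5 ≤ n) (hn8 : n ≠ 8) :
    ∃ g : Matrix (Fin n) (Fin n) F, IsUnit g ∧ ∀ x, xᵀ = -x → φ x * g = g * x := by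
  set Y : Fin n → Fin n → Matrix (Fin n) (Fin n) F := fun i j => φ (elemSkew F i j) with hY
  have hskew (i j) : (Y i j)ᵀ = -Y i j := h.skew _ (transpose_elemSkew i j)
  have hanti (i j) : Y i j = -Y j i := by
    simp only [hY]; rw [elemSkew_comm, map_neg]
  have hcube {i j} (hij : i ≠ j) : Y i j * Y i j * Y i j = -Y i j :=
    (h.elemSkew_spec h2 hn hn8 hij).1
  have hdisj {i j k l : Fin n} (hij : i ≠ j) (hkl : k ≠ l) (hik : i ≠ k) (hil : i ≠ l)
      (hjk : j ≠ k) (hjl : j ≠ l) : Y i j * Y k l = 0 :=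
    h.mul_eq_zero_of_disjoint h2 hn hn8 hij hkl hik hil hjk hjl
  have hlie {i j k : Fin n} (hij : i ≠ j) (hjk : j ≠ k) (hik : i ≠ k) :
      Y i j * Y j k - Y j k * Y i j = Y i k := by
    rw [← Ring.lie_def, ← h.lie _ _ (transpose_elemSkew i j) (transpose_elemSkew j k),
      lie_elemSkew hij hjk hik]
  have hne {i j} (hij : i ≠ j) : Y i j ≠ 0 := fun h0 =>
    elemSkew_ne_zero hij (h.inj _ (transpose_elemSkew i j) h0)
  have hkill {z : Fin n → F} (hz : ∀ k l : Fin n, k ≠ l → Y k l *ᵥ z = 0) : z = 0 := by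
    refine eq_zero_of_elemSkew_mulVec (by omega) fun k l _ => ?_
    obtain ⟨x, hx, hxs⟩ := h.surj _ (transpose_elemSkew (R := F) k l)
    have hz' (i j) : Y i j *ᵥ z = 0 := by
      by_cases hij : i = j
      · simp [hY, hij, elemSkew_self]
      · exact hz i j hij
    have hx' : x = (2 : F)⁻¹ • ∑ k, ∑ l, x k l • elemSkew F k l := by
      rw [← two_smul_eq_sum_elemSkew hx, smul_smul, inv_mul_cancel₀ h2, one_smul]
    rw [← hxs, hx']
    simp only [map_smul, map_sum, smul_mulVec, sum_mulVec]
    simp only [hY] at hz'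
    simp [hz']
  obtain ⟨o, -⟩ := exists_notMem_of_length_lt ([] : List (Fin n)) (by simp; omega)
  obtain ⟨t, hto⟩ := exists_notMem_of_length_lt [o] (by simp; omega)
  obtain ⟨j, hj⟩ := exists_notMem_of_length_lt [o, t] (by simp; omega)
  have hto : t ≠ o := by simpa using hto
  obtain ⟨hjo, hjt⟩ : j ≠ o ∧ j ≠ t := by simpa using hj
  have hindep {a b : Fin n} (hao : a ≠ o) (hat : a ≠ t) (hbo : b ≠ o) (hbt : b ≠ t) (hab : a ≠ b) :
      Y o a * Y a t = Y o b * Y b t := by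
    have e0 := hdisj hao.symm hbt hbo.symm hto.symm hab hat
    have e1 := hlie hao.symm hab hbo.symm
    have e2 := hlie hab hbt hat
    calc Y o a * Y a t = Y o a * Y a t + (Y o a * Y b t) * Y a b - Y a b * (Y o a * Y b t) := by
          rw [e0]; simp
      _ = Y o b * Y b t := by rw [← e1, ← e2]; noncomm_ring
  have hX0 : Y o j * Y j t ≠ 0 := by
    intro h0
    have h1 := congrArg transpose h0
    rw [transpose_mul, hskew, hskew, neg_mul_neg, transpose_zero] at h1
    have := hlie hjo.symm hjt hto.symm
    rw [h0, h1, sub_zero] at this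
    exact hne hto.symm this.symm
  have hYX {k l : Fin n} (hko : k ≠ o) (hlo : l ≠ o) (hkl : k ≠ l) :
      Y k l * (Y o j * Y j t) = 0 := by
    obtain ⟨m, hm⟩ := exists_notMem_of_length_lt [o, t, k, l] (by simp; omega)
    obtain ⟨hmo, hmt, hmk, hml⟩ : m ≠ o ∧ m ≠ t ∧ m ≠ k ∧ m ≠ l := by simpa using hm
    have : Y o j * Y j t = Y o m * Y m t := by
      by_cases hmj : j = m
      · rw [hmj]
      · exact hindep hjo hjt hmo hmt hmj
    rw [this, ← mul_assoc, hdisj hkl hmo.symm hko hmk.symm hlo hml.symm, zero_mul]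
  obtain ⟨u, hu⟩ : ∃ u, (Y o j * Y j t) *ᵥ u ≠ 0 := by
    by_contra! hcon
    exact hX0 (Matrix.toLin'.injective (LinearMap.ext fun v => by simpa using hcon v))
  set w := (Y o j * Y j t) *ᵥ u with hw
  have hYw {k l : Fin n} (hko : k ≠ o) (hlo : l ≠ o) (hkl : k ≠ l) : Y k l *ᵥ w = 0 := by
    rw [hw, mulVec_mulVec, hYX hko hlo hkl, zero_mulVec]
  clear_value w
  have hdv {i j k l : Fin n} (hij : i ≠ j) (hkl : k ≠ l) (hik : i ≠ k) (hil : i ≠ l)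
      (hjk : j ≠ k) (hjl : j ≠ l) (z : Fin n → F) : Y i j *ᵥ Y k l *ᵥ z = 0 := by
    rw [mulVec_mulVec, hdisj hij hkl hik hil hjk hjl, zero_mulVec]
  have hlv {i j k : Fin n} (hij : i ≠ j) (hjk : j ≠ k) (hik : i ≠ k) (z : Fin n → F) :
      Y i j *ᵥ Y j k *ᵥ z = Y i k *ᵥ z + Y j k *ᵥ Y i j *ᵥ z := by
    rw [← hlie hij hjk hik, mulVec_mulVec, mulVec_mulVec, sub_mulVec, sub_add_cancel]
  set v : Fin n → Fin n → F := fun i => if i = o then w else Y i o *ᵥ w with hv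
  have hvo : v o = w := by simp [hv]
  have hvi {i} (hi : i ≠ o) : v i = Y i o *ᵥ w := by simp [hv, hi]
  clear_value v
  have hb {k i : Fin n} (hki : k ≠ i) (hko : k ≠ o) : Y k i *ᵥ v i = v k := by
    by_cases hio : i = o
    · rw [hio, hvo, hvi hko]
    · rw [hvi hio, hvi hko, hlv hki hio hko, hYw hko hio hki, mulVec_zero, add_zero]
  have ha {k l i : Fin n} (hkl : k ≠ l) (hki : k ≠ i) (hli : l ≠ i) (hko : k ≠ o) :
      Y k l *ᵥ v i = 0 := by
    by_cases hio : i = o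
    · subst hio
      rw [hvo, hYw hko hli hkl]
    by_cases hlo : l = o
    · subst hlo
      obtain ⟨m, hm⟩ := exists_notMem_of_length_lt [l, k, i] (by simp; omega)
      obtain ⟨hml, hmk, hmi⟩ : m ≠ l ∧ m ≠ k ∧ m ≠ i := by simpa using hm
      rw [← hb hmi.symm hio, hdv hkl hmi.symm hki hmk.symm hli hml.symm]
    · rw [hvi hio, hdv hkl hio hki hko hli hlo]
  have ha' {l i : Fin n} (hlo : l ≠ o) (hio : i ≠ o) (hli : l ≠ i) : Y o l *ᵥ v i = 0 := by
    rw [hanti, neg_mulVec, ha hlo hli hio.symm hlo, neg_zero]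
  have hwi {a b : Fin n} (hao : a ≠ o) (hbo : b ≠ o) : Y o a *ᵥ v a = Y o b *ᵥ v b := by
    by_cases hab : a = b
    · rw [hab]
    rw [← hb hab hao, hlv hao.symm hab hbo.symm, ha' hao hbo hab, mulVec_zero, add_zero]
  have hb' {i : Fin n} (hio : i ≠ o) : Y o i *ᵥ v i = v o := by
    rw [← sub_eq_zero]
    refine hkill fun k l hkl => ?_
    have aux {m : Fin n} (hmo : m ≠ o) : Y m o *ᵥ (Y o i *ᵥ v i - v o) = 0 := by
      have := congrArg (· *ᵥ w) (hcube hmo)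
      simp only [← mulVec_mulVec, neg_mulVec] at this
      rw [hwi hio hmo, hvi hmo, hvo, hanti o m, mulVec_sub, neg_mulVec, mulVec_neg, this]
      simp
    by_cases hko : k = o
    · subst hko
      rw [hanti, neg_mulVec, aux hkl.symm, neg_zero]
    by_cases hlo : l = o
    · subst hlo
      exact aux hkl
    obtain ⟨m, hm⟩ := exists_notMem_of_length_lt [o, k, l] (by simp; omega)
    obtain ⟨hmo, hmk, hml⟩ : m ≠ o ∧ m ≠ k ∧ m ≠ l := by simpa using hm
    rw [hwi hio hmo, mulVec_sub, hvo, hYw hko hlo hkl, hdv hkl hmo.symm hko hmk.symm hlo hml.symm,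
      sub_zero]
  have hB {k i : Fin n} (hki : k ≠ i) : Y k i *ᵥ v i = v k := by
    by_cases hko : k = o
    · subst hko; exact hb' hki.symm
    · exact hb hki hko
  have hA {k l i : Fin n} (hkl : k ≠ l) (hki : k ≠ i) (hli : l ≠ i) : Y k l *ᵥ v i = 0 := by
    by_cases hko : k = o
    · subst hko; exact ha' hkl.symm hki.symm hli
    · exact ha hkl hki hli hko
  have hv0 (i : Fin n) : v i ≠ 0 := by
    intro h0
    apply hu
    by_cases hio : i = o
    · rw [← hvo, ← hio, h0]
    · rw [← hvo, ← hb' hio, h0, mulVec_zero]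
  have hgY (k l : Fin n) (hkl : k ≠ l) :
      φ (elemSkew F k l) * (Matrix.of v)ᵀ = (Matrix.of v)ᵀ * elemSkew F k l := by
    ext p q
    rw [mul_elemSkew_apply]
    change (Y k l *ᵥ v q) p = v k p * _ - v l p * _
    by_cases hlq : l = q
    · subst hlq
      rw [hB hkl]
      simp [hkl.symm]
    by_cases hkq : k = q
    · subst hkq
      rw [hanti, neg_mulVec, hB hkl.symm]
      simp [hkl]
    · rw [hA hkl hkq hlq]
      simp [Ne.symm hlq, Ne.symm hkq]
  have hg {x} (hx : xᵀ = -x) := mul_eq_mul_of_elemSkew h2 hgY hx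
  refine ⟨(Matrix.of v)ᵀ, ?_, fun x hx => hg hx⟩
  rw [← mulVec_injective_iff_isUnit]
  rw [← Matrix.coe_mulVecLin, injective_iff_map_eq_zero]
  intro c hc
  rw [Matrix.mulVecLin_apply] at hc
  by_contra hc0
  obtain ⟨l, hl⟩ := Function.ne_iff.1 hc0
  have hl : c l ≠ 0 := hl
  obtain ⟨k, hk⟩ := exists_notMem_of_length_lt [l] (by simp; omega)
  obtain ⟨m, hm⟩ := exists_notMem_of_length_lt [l, k] (by simp; omega)
  have hkl : k ≠ l := by simpa using hk
  obtain ⟨hml, hmk⟩ : m ≠ l ∧ m ≠ k := by simpa using hm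
  have e1 : (Matrix.of v)ᵀ *ᵥ elemSkew F m k *ᵥ elemSkew F k l *ᵥ c = 0 := by
    rw [mulVec_mulVec, ← hg (transpose_elemSkew m k), ← mulVec_mulVec, mulVec_mulVec c,
      ← hg (transpose_elemSkew k l), ← mulVec_mulVec, hc, mulVec_zero, mulVec_zero]
  rw [elemSkew_mulVec, elemSkew_mulVec] at e1
  simp [hkl, hkl.symm, hml, hmk, mulVec_smul] at e1
  exact e1.elim hl (hv0 m)

end IsSkewLieAut

end frame

section derivation
variable {S : Type*} [CommRing S] {n : ℕ}

/-- The relations satisfied by the values on `E_ij - E_ji` of a derivation of the Lie algebra of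
skew-symmetric matrices into skew-symmetric matrices. -/
structure IsSkewDerivation (d : Fin n → Fin n → Matrix (Fin n) (Fin n) S) : Prop where
  skew : ∀ i j, (d i j)ᵀ = -d i j
  anti : ∀ i j, d i j = -d j i
  disjoint : ∀ i j k l, i ≠ j → k ≠ l → i ≠ k → i ≠ l → j ≠ k → j ≠ l →
    ⁅d i j, elemSkew S k l⁆ + ⁅elemSkew S i j, d k l⁆ = 0
  adjacent : ∀ i j k, i ≠ j → j ≠ k → i ≠ k →
    d i k = ⁅d i j, elemSkew S j k⁆ + ⁅elemSkew S i j, d j k⁆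

namespace IsSkewDerivation
variable {d : Fin n → Fin n → Matrix (Fin n) (Fin n) S}

theorem skew_apply (hd : IsSkewDerivation d) (i j p q : Fin n) : d i j p q = -d i j q p :=
  congrFun (congrFun (hd.skew i j) q) p

theorem anti_apply (hd : IsSkewDerivation d) (i j p q : Fin n) : d i j p q = -d j i p q :=
  congrFun (congrFun (hd.anti i j) p) q

theorem diag (hd : IsSkewDerivation d) (h2 : IsUnit (2 : S)) (i j p : Fin n) : d i j p p = 0 := by
  have h := hd.skew_apply i j p p
  have : (2 : S) * d i j p p = 0 := by linear_combination h
  exact h2.mul_right_eq_zero.1 this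

theorem lie_apply (A : Matrix (Fin n) (Fin n) S) (k l p q : Fin n) :
    ⁅A, elemSkew S k l⁆ p q =
      A p k * (Pi.single l 1 : Fin n → S) q - A p l * (Pi.single k 1 : Fin n → S) q -
      ((Pi.single k 1 : Fin n → S) p * A l q - (Pi.single l 1 : Fin n → S) p * A k q) := by
  rw [Ring.lie_def, Matrix.sub_apply, mul_elemSkew_apply, elemSkew_mul_apply]

theorem lie_apply' (A : Matrix (Fin n) (Fin n) S) (k l p q : Fin n) :
    ⁅elemSkew S k l, A⁆ p q =
      ((Pi.single k 1 : Fin n → S) p * A l q - (Pi.single l 1 : Fin n → S) p * A k q) -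
      (A p k * (Pi.single l 1 : Fin n → S) q - A p l * (Pi.single k 1 : Fin n → S) q) := by
  rw [Ring.lie_def, Matrix.sub_apply, mul_elemSkew_apply, elemSkew_mul_apply]

theorem coeff_add_of_ne (hd : IsSkewDerivation d) {j k i l : Fin n} (hjk : j ≠ k) (hij : i ≠ j)
    (hik : i ≠ k) (hlj : l ≠ j) (hlk : l ≠ k) (hil : i ≠ l) :
    d j i k i + d k l j l = 0 := by
  have := congrFun (congrFun (hd.disjoint i j k l hij hlk.symm hik hil hjk hlj.symm) i) l
  rw [Matrix.add_apply, lie_apply, lie_apply'] at this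
  simp [hij, hik, hil, hlj, hlk] at this
  rw [← this, hd.anti_apply i j, hd.skew_apply j i i k]
  ring

theorem coeff_add (hn : 5 ≤ n) (hd : IsSkewDerivation d) {j k i l : Fin n} (hjk : j ≠ k)
    (hij : i ≠ j) (hik : i ≠ k) (hlj : l ≠ j) (hlk : l ≠ k) :
    d j i k i + d k l j l = 0 := by
  by_cases hil : i = l
  · subst hil
    obtain ⟨m, hm⟩ := exists_notMem_of_length_lt [i, j, k] (by simp; omega)
    obtain ⟨hmi, hmj, hmk⟩ : m ≠ i ∧ m ≠ j ∧ m ≠ k := by simpa using hm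
    obtain ⟨r, hr⟩ := exists_notMem_of_length_lt [i, j, k, m] (by simp; omega)
    obtain ⟨hri, hrj, hrk, hrm⟩ : r ≠ i ∧ r ≠ j ∧ r ≠ k ∧ r ≠ m := by simpa using hr
    have e1 := hd.coeff_add_of_ne hjk hij hik hmj hmk hmi.symm
    have e2 := hd.coeff_add_of_ne hjk hrj hrk hmj hmk hrm
    have e3 := hd.coeff_add_of_ne hjk hrj hrk hij hik hri
    linear_combination e1 - e2 + e3
  · exact hd.coeff_add_of_ne hjk hij hik hlj hlk hil

theorem apply_of_notMem (hn : 5 ≤ n) (hd : IsSkewDerivation d) (h2 : IsUnit (2 : S))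
    {i j p q : Fin n} (hij : i ≠ j) (hpi : p ≠ i) (hpj : p ≠ j) (hqi : q ≠ i) (hqj : q ≠ j) :
    d i j p q = 0 := by
  by_cases hpq : p = q
  · rw [hpq, hd.diag h2]
  obtain ⟨l, hl⟩ := exists_notMem_of_length_lt [i, j, p, q] (by simp; omega)
  obtain ⟨hli, hlj, hlp, hlq⟩ : l ≠ i ∧ l ≠ j ∧ l ≠ p ∧ l ≠ q := by simpa using hl
  have := congrFun (congrFun (hd.disjoint i j q l hij hlq.symm hqi.symm hli.symm hqj.symm
    hlj.symm) p) l
  rw [Matrix.add_apply, lie_apply, lie_apply'] at this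
  simpa [hij, hpi, hpj, hqi, hqj, hpq, hli, hlj, hlp, hlq, hlp.symm] using this

theorem apply_self (hn : 5 ≤ n) (hd : IsSkewDerivation d) (h2 : IsUnit (2 : S))
    {i j : Fin n} (hij : i ≠ j) : d i j i j = 0 := by
  have key {i j k : Fin n} (hij : i ≠ j) (hjk : j ≠ k) (hik : i ≠ k) :
      d i k i k = d i j i j + d j k j k := by
    have := congrFun (congrFun (hd.adjacent i j k hij hjk hik) i) k
    rw [Matrix.add_apply, lie_apply, lie_apply'] at this
    simpa [hij, hjk, hik, hij.symm, hjk.symm, hik.symm] using this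
  have hsymm (i j) : d i j i j = d j i j i := by
    rw [hd.anti_apply, hd.skew_apply, neg_neg]
  obtain ⟨k, hk⟩ := exists_notMem_of_length_lt [i, j] (by simp; omega)
  obtain ⟨hki, hkj⟩ : k ≠ i ∧ k ≠ j := by simpa using hk
  have e1 := key hki hij hkj
  have e2 := key hkj hij.symm hki
  rw [← hsymm i j] at e2
  have : (2 : S) * d i j i j = 0 := by linear_combination e1.symm + e2.symm
  exact h2.mul_right_eq_zero.1 this

theorem eq_lie (hn : 5 ≤ n) (hd : IsSkewDerivation d) (h2 : IsUnit (2 : S))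
    {a : Matrix (Fin n) (Fin n) S} (ha : aᵀ = -a)
    (had : ∀ i j k, i ≠ j → k ≠ i → k ≠ j → a k i = d i j k j) {i j : Fin n} (hij : i ≠ j) :
    d i j = ⁅a, elemSkew S i j⁆ := by
  have ha' (p q) : a p q = -a q p := congrFun (congrFun ha q) p
  have hadiag (p) : a p p = 0 := by
    have : (2 : S) * a p p = 0 := by linear_combination ha' p p
    exact h2.mul_right_eq_zero.1 this
  have hout (p q) (hpi : p ≠ i) (hpj : p ≠ j) : d i j p q = ⁅a, elemSkew S i j⁆ p q := by
    rw [lie_apply]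
    by_cases hqi : q = i
    · subst hqi
      rw [hd.anti_apply, ← had j q p hij.symm hpj hpi]
      simp [hij, hpi, hpj]
    by_cases hqj : q = j
    · subst hqj
      rw [← had i q p hij hpi hpj]
      simp [hij.symm, hpi, hpj]
    · rw [hd.apply_of_notMem hn h2 hij hpi hpj hqi hqj]
      simp [hpi, hpj, hqi, hqj]
  have hswap (p q) : ⁅a, elemSkew S i j⁆ p q = -⁅a, elemSkew S i j⁆ q p :=
    congrFun (congrFun (lie_transpose_skew ha (transpose_elemSkew i j)) q) p
  ext p q
  by_cases hp : p ≠ i ∧ p ≠ j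
  · exact hout p q hp.1 hp.2
  by_cases hq : q ≠ i ∧ q ≠ j
  · rw [hd.skew_apply, hswap, hout q p hq.1 hq.2]
  have hp : p = i ∨ p = j := by tauto
  have hq : q = i ∨ q = j := by tauto
  have e1 : d i j i j = ⁅a, elemSkew S i j⁆ i j := by
    rw [hd.apply_self hn h2 hij, lie_apply]
    simp [hij, hij.symm, hadiag]
  have e2 (r) : ⁅a, elemSkew S i j⁆ r r = 0 := by
    have : (2 : S) * ⁅a, elemSkew S i j⁆ r r = 0 := by linear_combination hswap r r
    exact h2.mul_right_eq_zero.1 this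
  rcases hp with rfl | rfl <;> rcases hq with rfl | rfl
  · rw [hd.diag h2, e2]
  · exact e1
  · rw [hd.skew_apply, hswap, e1]
  · rw [hd.diag h2, e2]

end IsSkewDerivation
end derivation

section lifting
variable {S : Type*} [CommRing S] {n : ℕ}

/-- The relations satisfied by the matrices `E_ij - E_ji` inside the Lie algebra of skew-symmetric
matrices. -/
structure IsSkewFamily (η : Fin n → Fin n → Matrix (Fin n) (Fin n) S) : Prop where
  skew : ∀ i j, (η i j)ᵀ = -η i j
  anti : ∀ i j, η i j = -η j i
  disjoint : ∀ i j k l, i ≠ j → k ≠ l → i ≠ k → i ≠ l → j ≠ k → j ≠ l → ⁅η i j, η k l⁆ = 0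
  adjacent : ∀ i j k, i ≠ j → j ≠ k → i ≠ k → η i k = ⁅η i j, η j k⁆

theorem Matrix.mul_mul_eq_zero_of_forall {A B : Matrix (Fin n) (Fin n) S}
    (h : ∀ p q r s, A p q * B r s = 0) (M : Matrix (Fin n) (Fin n) S) : A * M * B = 0 := by
  ext p s
  simp only [Matrix.mul_apply, Matrix.zero_apply, Finset.sum_mul]
  refine Finset.sum_eq_zero fun q _ => Finset.sum_eq_zero fun r _ => ?_
  linear_combination M r q * h p r q s

theorem Matrix.mul_eq_zero_of_forall {A B : Matrix (Fin n) (Fin n) S}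
    (h : ∀ p q r s, A p q * B r s = 0) : A * B = 0 := by
  simpa using mul_mul_eq_zero_of_forall h 1

namespace IsSkewFamily
variable {η : Fin n → Fin n → Matrix (Fin n) (Fin n) S}

theorem map {T : Type*} [CommRing T] (hη : IsSkewFamily η) (f : S →+* T) :
    IsSkewFamily fun i j => f.mapMatrix (η i j) where
  skew i j := by
    have := congrArg f.mapMatrix (hη.skew i j)
    rwa [map_neg, RingHom.mapMatrix_apply, Matrix.transpose_map] at this
  anti i j := by
    rw [← map_neg, ← hη.anti]
  disjoint i j k l h1 h2 h3 h4 h5 h6 := by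
    rw [Ring.lie_def, ← map_mul, ← map_mul, ← map_sub, ← Ring.lie_def,
      hη.disjoint i j k l h1 h2 h3 h4 h5 h6, map_zero]
  adjacent i j k h1 h2 h3 := by
    rw [Ring.lie_def, ← map_mul, ← map_mul, ← map_sub, ← Ring.lie_def,
      ← hη.adjacent i j k h1 h2 h3]

theorem conj (hη : IsSkewFamily η) {h : Matrix (Fin n) (Fin n) S} (hh : hᵀ * h = 1) :
    IsSkewFamily fun i j => h * η i j * hᵀ where
  skew i j := by
    rw [Matrix.transpose_mul, Matrix.transpose_mul, hη.skew, Matrix.transpose_transpose]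
    noncomm_ring
  anti i j := by
    rw [hη.anti i j]
    noncomm_ring
  disjoint i j k l h1 h2 h3 h4 h5 h6 := by
    have e : ⁅h * η i j * hᵀ, h * η k l * hᵀ⁆ =
      h * (η i j * (hᵀ * h) * η k l - η k l * (hᵀ * h) * η i j) * hᵀ := by
      rw [Ring.lie_def]; noncomm_ring
    rw [e, hh, mul_one, mul_one, ← Ring.lie_def, hη.disjoint i j k l h1 h2 h3 h4 h5 h6]
    simp
  adjacent i j k h1 h2 h3 := by
    have e : ⁅h * η i j * hᵀ, h * η j k * hᵀ⁆ =
      h * (η i j * (hᵀ * h) * η j k - η j k * (hᵀ * h) * η i j) * hᵀ := by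
      rw [Ring.lie_def]; noncomm_ring
    rw [e, hh, mul_one, mul_one, ← Ring.lie_def, ← hη.adjacent i j k h1 h2 h3]

theorem isSkewDerivation (hη : IsSkewFamily η) {J : Ideal S} (hJ : ∀ x ∈ J, ∀ y ∈ J, x * y = 0)
    (hX : ∀ i j p q, η i j p q - elemSkew S i j p q ∈ J) :
    IsSkewDerivation fun i j => η i j - elemSkew S i j where
  skew i j := by
    rw [Matrix.transpose_sub, hη.skew, transpose_elemSkew]
    abel
  anti i j := by
    rw [hη.anti i j, elemSkew_comm i j]
    abel
  disjoint i j k l h1 h2 h3 h4 h5 h6 := by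
    have e1 := hη.disjoint i j k l h1 h2 h3 h4 h5 h6
    have e2 := lie_elemSkew_of_disjoint (R := S) h3 h4 h5 h6
    have e3 : (η i j - elemSkew S i j) * (η k l - elemSkew S k l) = 0 :=
      Matrix.mul_eq_zero_of_forall fun p q r s => hJ _ (hX i j p q) _ (hX k l r s)
    have e4 : (η k l - elemSkew S k l) * (η i j - elemSkew S i j) = 0 :=
      Matrix.mul_eq_zero_of_forall fun p q r s => hJ _ (hX k l p q) _ (hX i j r s)
    simp only [Ring.lie_def] at *
    linear_combination (norm := noncomm_ring) e1 - e2 - e3 + e4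
  adjacent i j k h1 h2 h3 := by
    have e1 := hη.adjacent i j k h1 h2 h3
    have e2 := lie_elemSkew (R := S) h1 h2 h3
    have e3 : (η i j - elemSkew S i j) * (η j k - elemSkew S j k) = 0 :=
      Matrix.mul_eq_zero_of_forall fun p q r s => hJ _ (hX i j p q) _ (hX j k r s)
    have e4 : (η j k - elemSkew S j k) * (η i j - elemSkew S i j) = 0 :=
      Matrix.mul_eq_zero_of_forall fun p q r s => hJ _ (hX j k p q) _ (hX i j r s)
    simp only [Ring.lie_def] at *
    linear_combination (norm := noncomm_ring) e1 + e2 + e3 - e4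

theorem exists_eq_add_lie (hn : 5 ≤ n) (h2 : IsUnit (2 : S)) (hη : IsSkewFamily η) {J : Ideal S}
    (hJ : ∀ x ∈ J, ∀ y ∈ J, x * y = 0) (hX : ∀ i j p q, η i j p q - elemSkew S i j p q ∈ J) :
    ∃ a : Matrix (Fin n) (Fin n) S, aᵀ = -a ∧ (∀ p q, a p q ∈ J) ∧
      ∀ i j, i ≠ j → η i j = elemSkew S i j + ⁅a, elemSkew S i j⁆ := by
  have hd := hη.isSkewDerivation hJ hX
  have hex : ∀ i k : Fin n, ∃ j, j ≠ i ∧ j ≠ k := fun i k => by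
    obtain ⟨j, hj⟩ := exists_notMem_of_length_lt [i, k] (by simp; omega)
    exact ⟨j, by simpa using hj⟩
  choose f hf1 hf2 using hex
  set a : Matrix (Fin n) (Fin n) S := Matrix.of fun k i =>
    if k = i then 0 else (η i (f i k) - elemSkew S i (f i k)) k (f i k) with ha
  have hap : ∀ k i, a k i = if k = i then 0 else
    (η i (f i k) - elemSkew S i (f i k)) k (f i k) := fun k i => rfl
  have hcoeff : ∀ {j k i l : Fin n}, j ≠ k → i ≠ j → i ≠ k → l ≠ j → l ≠ k →
      (η j i - elemSkew S j i) k i + (η k l - elemSkew S k l) j l = 0 :=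
    fun h1 h2 h3 h4 h5 => hd.coeff_add hn h1 h2 h3 h4 h5
  have hsk : aᵀ = -a := by
    ext k i
    rw [Matrix.transpose_apply, Matrix.neg_apply, hap, hap]
    by_cases hki : k = i
    · simp [hki]
    · rw [if_neg hki, if_neg (Ne.symm hki)]
      exact eq_neg_of_add_eq_zero_left
        (hcoeff hki (hf1 _ _) (hf2 _ _) (hf2 _ _) (hf1 _ _))
  refine ⟨a, hsk, fun p q => ?_, fun i j hij => ?_⟩
  · rw [hap]
    split_ifs
    · exact J.zero_mem
    · exact hX _ _ _ _
  · have := hd.eq_lie hn h2 hsk (fun i j k hij hki hkj => ?_) hij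
    · rw [← this]; abel
    · rw [hap, if_neg hki]
      have e1 := hcoeff (Ne.symm hki) (hf1 i k) (hf2 i k) hij.symm hkj.symm
      have e2 := hcoeff (Ne.symm hki) hij.symm hkj.symm hij.symm hkj.symm
      linear_combination e1 - e2

end IsSkewFamily
end lifting

section lifting
variable {R : Type*} [CommRing R] {n : ℕ}

theorem Matrix.pow_apply_mem_pow {I : Ideal R} {c : Matrix (Fin n) (Fin n) R}
    (hc : ∀ p q, c p q ∈ I) (k : ℕ) (p q : Fin n) : (c ^ k) p q ∈ I ^ k := by
  induction k generalizing p q with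
  | zero => simp
  | succ k ih =>
    rw [pow_succ, pow_succ, Matrix.mul_apply]
    exact Ideal.sum_mem _ fun r _ => Ideal.mul_mem_mul (ih p r) (hc r q)

/-- The Cayley transform of a nilpotent skew-symmetric matrix. -/
theorem Matrix.exists_orthogonal_of_isNilpotent {c : Matrix (Fin n) (Fin n) R} (hc : cᵀ = -c)
    (hn : IsNilpotent c) :
    ∃ h : Matrix (Fin n) (Fin n) R, hᵀ * h = 1 ∧ h * hᵀ = 1 ∧ (1 - c) * h = 1 + c := by
  obtain ⟨u, hu⟩ := hn.isUnit_one_sub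
  set v : Matrix (Fin n) (Fin n) R := ↑u⁻¹ with hv
  have huv : (1 - c) * v = 1 := by rw [← hu, hv]; exact u.mul_inv
  have hvu : v * (1 - c) = 1 := by rw [← hu, hv]; exact u.inv_mul
  have hvt : (1 + c) * vᵀ = 1 := by
    have := congrArg Matrix.transpose hvu
    rwa [Matrix.transpose_mul, Matrix.transpose_sub, hc, Matrix.transpose_one, sub_neg_eq_add]
      at this
  have key : (v * (1 + c)) * (v * (1 + c))ᵀ = 1 := by
    rw [Matrix.transpose_mul, Matrix.transpose_add, hc, Matrix.transpose_one]
    calc v * (1 + c) * ((1 + -c) * vᵀ) = (v * (1 - c)) * ((1 + c) * vᵀ) := by noncomm_ring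
      _ = 1 := by rw [hvu, hvt, one_mul]
  exact ⟨v * (1 + c), mul_eq_one_comm.1 key, key, by rw [← mul_assoc, huv, one_mul]⟩

theorem mapMatrix_elemSkew {T : Type*} [CommRing T] (f : R →+* T) (i j : Fin n) :
    f.mapMatrix (elemSkew R i j) = elemSkew T i j := by
  ext p q
  simp [elemSkew, wedge_apply, Pi.single_apply, apply_ite f]

namespace IsSkewFamily
variable {η : Fin n → Fin n → Matrix (Fin n) (Fin n) R}

theorem apply_self (h2 : IsUnit (2 : R)) (hη : IsSkewFamily η) (i : Fin n) : η i i = 0 := by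
  ext p q
  have := congrFun (congrFun (hη.anti i i) p) q
  rw [Matrix.neg_apply] at this
  refine h2.mul_right_eq_zero.1 ?_
  change (2 : R) * η i i p q = 0
  linear_combination this

theorem exists_conj_sub_mem_sq (hn : 5 ≤ n) (h2 : IsUnit (2 : R)) (hη : IsSkewFamily η)
    {I : Ideal R} (hI : IsNilpotent I) (hX : ∀ i j p q, η i j p q - elemSkew R i j p q ∈ I) :
    ∃ h : Matrix (Fin n) (Fin n) R, hᵀ * h = 1 ∧ h * hᵀ = 1 ∧
      ∀ i j p q, (h * η i j * hᵀ) p q - elemSkew R i j p q ∈ I ^ 2 := by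
  set π := Ideal.Quotient.mk (I ^ 2)
  have hJ : ∀ x ∈ I.map π, ∀ y ∈ I.map π, x * y = 0 := by
    intro x hx y hy
    obtain ⟨x, hx', rfl⟩ := (Ideal.mem_map_iff_of_surjective _ Ideal.Quotient.mk_surjective).1 hx
    obtain ⟨y, hy', rfl⟩ := (Ideal.mem_map_iff_of_surjective _ Ideal.Quotient.mk_surjective).1 hy
    rw [← map_mul, Ideal.Quotient.eq_zero_iff_mem, pow_two]
    exact Ideal.mul_mem_mul hx' hy'
  have hXm (i j : Fin n) : π.mapMatrix (elemSkew R i j) = elemSkew (R ⧸ I ^ 2) i j :=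
    mapMatrix_elemSkew π i j
  obtain ⟨a, hask, haJ, ha⟩ := (hη.map π).exists_eq_add_lie hn (by simpa only [map_ofNat] using h2.map π) hJ
    (fun i j p q => by
      rw [← hXm]
      simp only [RingHom.mapMatrix_apply, Matrix.map_apply]
      rw [← map_sub]
      exact Ideal.mem_map_of_mem _ (hX i j p q))
  have hlift : ∀ p q, ∃ r ∈ I, π r = a p q := fun p q =>
    (Ideal.mem_map_iff_of_surjective _ Ideal.Quotient.mk_surjective).1 (haJ p q)
  choose b hbI hb using hlift
  obtain ⟨t, ht⟩ := h2.exists_right_inv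
  set c : Matrix (Fin n) (Fin n) R := Matrix.of fun p q => t * t * (b q p - b p q) with hc
  have hcsk : cᵀ = -c := by
    ext p q
    simp only [hc, Matrix.transpose_apply, Matrix.of_apply, Matrix.neg_apply]
    ring
  have hcI : ∀ p q, c p q ∈ I := fun p q => I.mul_mem_left _ (I.sub_mem (hbI _ _) (hbI _ _))
  have hcnil : IsNilpotent c := by
    obtain ⟨N, hN⟩ := hI
    refine ⟨N, ?_⟩
    ext p q
    have := Matrix.pow_apply_mem_pow hcI N p q
    rw [hN] at this
    simpa using this
  have ha' (p q) : a p q = -a q p := congrFun (congrFun hask q) p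
  have ht' : (2 : R ⧸ I ^ 2) * π t = 1 := by
    rw [← map_ofNat π 2, ← map_mul, ht, map_one]
  have hca : 2 * π.mapMatrix c = -a := by
    ext p q
    have : (π.mapMatrix c) p q = π t * π t * (a q p - a p q) := by
      simp [hc, hb]
    rw [two_mul, Matrix.add_apply, this, Matrix.neg_apply, ha' q p]
    linear_combination (-(2 * π t) * a p q - a p q) * ht'
  have hcc : π.mapMatrix c * π.mapMatrix c = 0 :=
    Matrix.mul_eq_zero_of_forall fun p q r s =>
      hJ _ (Ideal.mem_map_of_mem _ (hcI p q)) _ (Ideal.mem_map_of_mem _ (hcI r s))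
  have haa (M) : a * M * a = 0 := Matrix.mul_mul_eq_zero_of_forall (fun p q r s =>
      hJ _ (haJ p q) _ (haJ r s)) M
  have haa' : a * a = 0 := Matrix.mul_eq_zero_of_forall (fun p q r s => hJ _ (haJ p q) _ (haJ r s))
  obtain ⟨h, hh1, hh2, hh3⟩ := Matrix.exists_orthogonal_of_isNilpotent hcsk hcnil
  refine ⟨h, hh1, hh2, fun i j p q => ?_⟩
  have hw : π.mapMatrix h = 1 - a := by
    have := congrArg π.mapMatrix hh3
    rw [map_mul, map_sub, map_add, map_one] at this
    have e : (1 + π.mapMatrix c) * ((1 - π.mapMatrix c) * π.mapMatrix h) =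
      π.mapMatrix h - (π.mapMatrix c * π.mapMatrix c) * π.mapMatrix h := by noncomm_ring
    rw [this, hcc, zero_mul, sub_zero] at e
    have e' : (1 + π.mapMatrix c) * (1 + π.mapMatrix c) =
      1 + 2 * π.mapMatrix c + π.mapMatrix c * π.mapMatrix c := by noncomm_ring
    rw [← e, e', hcc, hca, add_zero, sub_eq_add_neg]
  by_cases hij : i = j
  · subst hij
    rw [hη.apply_self h2, elemSkew_self]
    simp
  have hcomm : π.mapMatrix h * π.mapMatrix (η i j) = elemSkew _ i j * π.mapMatrix h := by
    have := ha i j hij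
    rw [hw, this, Ring.lie_def]
    have e : (1 - a) * (elemSkew (R ⧸ I ^ 2) i j + (a * elemSkew _ i j - elemSkew _ i j * a)) =
      elemSkew _ i j * (1 - a) - a * a * elemSkew _ i j + a * elemSkew _ i j * a := by
      noncomm_ring
    rw [e, haa, haa']
    simp
  have hfin : π.mapMatrix (h * η i j * hᵀ) = π.mapMatrix (elemSkew R i j) := by
    rw [map_mul, map_mul, hcomm, mul_assoc, ← map_mul, hh2, map_one, mul_one, hXm]
  rw [← Ideal.Quotient.eq]
  exact congrFun (congrFun hfin p) q

theorem exists_conj_eq (hn : 5 ≤ n) (h2 : IsUnit (2 : R)) (hη : IsSkewFamily η)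
    {I : Ideal R} (hI : IsNilpotent I) (hX : ∀ i j p q, η i j p q - elemSkew R i j p q ∈ I) :
    ∃ h : Matrix (Fin n) (Fin n) R, hᵀ * h = 1 ∧ h * hᵀ = 1 ∧
      ∀ i j, h * η i j * hᵀ = elemSkew R i j := by
  have key (k : ℕ) : ∃ h : Matrix (Fin n) (Fin n) R, hᵀ * h = 1 ∧ h * hᵀ = 1 ∧
      ∀ i j p q, (h * η i j * hᵀ) p q - elemSkew R i j p q ∈ I ^ (2 ^ k) := by
    induction k with
    | zero => exact ⟨1, by simp, by simp, by simpa using hX⟩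
    | succ k ih =>
      obtain ⟨h, hh1, hh2, hh⟩ := ih
      obtain ⟨h', hh1', hh2', hh'⟩ := (hη.conj hh1).exists_conj_sub_mem_sq hn h2
        (I := I ^ 2 ^ k) (hI.pow_of_pos (by positivity)) hh
      refine ⟨h' * h, ?_, ?_, fun i j p q => ?_⟩
      · rw [Matrix.transpose_mul, mul_assoc, ← mul_assoc _ h', hh1', one_mul, hh1]
      · rw [Matrix.transpose_mul, mul_assoc, ← mul_assoc h, hh2, one_mul, hh2']
      · rw [pow_succ, pow_mul]
        have e : h' * h * η i j * (h' * h)ᵀ = h' * (h * η i j * hᵀ) * h'ᵀ := by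
          rw [Matrix.transpose_mul]
          noncomm_ring
        rw [e]
        exact hh' i j p q
  obtain ⟨N, hN⟩ := hI
  obtain ⟨h, hh1, hh2, hh⟩ := key N
  refine ⟨h, hh1, hh2, fun i j => ?_⟩
  ext p q
  have := Ideal.pow_le_pow_right Nat.lt_two_pow_self.le (hh i j p q)
  rw [hN] at this
  exact sub_eq_zero.1 this

end IsSkewFamily
end lifting

section extension
variable {F : Type*} [Field F] {R : Type*} [CommRing R] [Algebra F R] {n : ℕ}

/-- Conjugation by a pair of mutually inverse elements, as an algebra endomorphism. -/
def conjAlgHom {A : Type*} [Ring A] [Algebra F A] (a b : A) (hab : a * b = 1) (hba : b * a = 1) :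
    A →ₐ[F] A :=
  AlgHom.ofLinearMap (LinearMap.mulLeft F a ∘ₗ LinearMap.mulRight F b)
    (by simp [hab])
    (fun x y => by
      simp only [LinearMap.comp_apply, LinearMap.mulLeft_apply, LinearMap.mulRight_apply]
      calc a * (x * y * b) = a * (x * 1 * y * b) := by rw [mul_one]
        _ = a * (x * b) * (a * (y * b)) := by rw [← hba]; noncomm_ring)

theorem conjAlgHom_apply {A : Type*} [Ring A] [Algebra F A] (a b : A) (hab : a * b = 1)
    (hba : b * a = 1) (x : A) : conjAlgHom (F := F) a b hab hba x = a * (x * b) := rfl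

/-- A Lie algebra homomorphism from skew-symmetric matrices over `F` to skew-symmetric matrices
over a local `F`-algebra with nilpotent maximal ideal, injective on the residue field, extends to
a homomorphism of matrix algebras. -/
theorem exists_algHom_extending_skew [IsAlgClosed F] (h2 : (2 : F) ≠ 0) (hn : 5 ≤ n) (hn8 : n ≠ 8)
    (ε : R →ₐ[F] F) (hε : IsNilpotent (RingHom.ker ε))
    (η : Matrix (Fin n) (Fin n) F →ₗ[F] Matrix (Fin n) (Fin n) R)
    (hskew : ∀ x, xᵀ = -x → (η x)ᵀ = -η x)
    (hlie : ∀ x y, xᵀ = -x → yᵀ = -y → η ⁅x, y⁆ = ⁅η x, η y⁆)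
    (hinj : ∀ x, xᵀ = -x → ε.mapMatrix (η x) = 0 → x = 0) :
    ∃ Φ : Matrix (Fin n) (Fin n) F →ₐ[F] Matrix (Fin n) (Fin n) R, ∀ x, xᵀ = -x → Φ x = η x := by
  set φ : Matrix (Fin n) (Fin n) F →ₗ[F] Matrix (Fin n) (Fin n) F :=
    ε.mapMatrix.toLinearMap ∘ₗ η with hφ
  have hφa (x) : φ x = ε.mapMatrix (η x) := rfl
  have hφ : IsSkewLieAut φ :=
    { skew := fun x hx => by
        rw [hφa, ← map_neg, ← hskew x hx, AlgHom.mapMatrix_apply, AlgHom.mapMatrix_apply,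
          Matrix.transpose_map]
      lie := fun x y hx hy => by
        rw [hφa, hlie x y hx hy]
        simp only [hφa, Ring.lie_def, map_sub, map_mul]
      inj := hinj }
  have hsurj := fun i j : Fin n => hφ.surj (elemSkew F i j) (transpose_elemSkew i j)
  choose x hxs hx using hsurj
  have hli {a b : Matrix (Fin n) (Fin n) F} (ha : aᵀ = -a) (hb : bᵀ = -b) : ⁅a, b⁆ᵀ = -⁅a, b⁆ :=
    lie_transpose_skew ha hb
  have hinj' {a b : Matrix (Fin n) (Fin n) F} (ha : aᵀ = -a) (hb : bᵀ = -b) (hab : φ a = φ b) :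
      a = b := by
    refine sub_eq_zero.1 (hφ.inj _ ?_ ?_)
    · rw [Matrix.transpose_sub, ha, hb]; abel
    · rw [map_sub, hab, sub_self]
  have hfam : IsSkewFamily fun i j => η (x i j) :=
    { skew := fun i j => hskew _ (hxs i j)
      anti := fun i j => by
        rw [← map_neg]
        congr 1
        refine hinj' (hxs i j) (by rw [Matrix.transpose_neg, hxs]) ?_
        rw [map_neg, hx, hx, elemSkew_comm]
      disjoint := fun i j k l h1 h2 h3 h4 h5 h6 => by
        rw [← hlie _ _ (hxs i j) (hxs k l),
          hφ.inj _ (hli (hxs i j) (hxs k l)) (by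
            rw [hφ.lie _ _ (hxs i j) (hxs k l), hx, hx, lie_elemSkew_of_disjoint h3 h4 h5 h6]),
          map_zero]
      adjacent := fun i j k h1 h2 h3 => by
        rw [← hlie _ _ (hxs i j) (hxs j k)]
        congr 1
        refine hinj' (hxs i k) (hli (hxs i j) (hxs j k)) ?_
        rw [hφ.lie _ _ (hxs i j) (hxs j k), hx, hx, hx, lie_elemSkew h1 h2 h3] }
  have h2R : IsUnit (2 : R) := by
    have := (isUnit_iff_ne_zero.2 h2).map (algebraMap F R)
    simpa only [map_ofNat] using this
  obtain ⟨h, hh1, hh2, hh⟩ := hfam.exists_conj_eq hn h2R hε (fun i j p q => by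
    rw [RingHom.mem_ker, map_sub, sub_eq_zero]
    have e1 : ε.mapMatrix (η (x i j)) = (ε : R →+* F).mapMatrix (elemSkew R i j) := by
      rw [← hφa, hx, mapMatrix_elemSkew]
    exact congrFun (congrFun e1 p) q)
  have hall (y : Matrix (Fin n) (Fin n) F) (hy : yᵀ = -y) :
      h * η y * hᵀ = (Algebra.ofId F R).mapMatrix (φ y) := by
    have e1 := two_smul_eq_sum_elemSkew (hφ.skew y hy)
    have e2 : (2 : F) • y = ∑ k, ∑ l, φ y k l • x k l := by
      refine hinj' ?_ ?_ ?_
      · rw [Matrix.transpose_smul, hy, smul_neg]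
      · simp only [Matrix.transpose_sum, Matrix.transpose_smul, hxs, smul_neg,
          Finset.sum_neg_distrib]
      · simp only [map_smul, map_sum, hx]
        exact e1
    obtain ⟨ψ, hψ⟩ : ∃ ψ : Matrix (Fin n) (Fin n) F →ₗ[F] Matrix (Fin n) (Fin n) R,
        ∀ z, ψ z = h * η z * hᵀ :=
      ⟨LinearMap.mulRight F hᵀ ∘ₗ LinearMap.mulLeft F h ∘ₗ η, fun _ => rfl⟩
    rw [← hψ]
    have e3 : (2 : F) • ψ y = (2 : F) • (Algebra.ofId F R).mapMatrix (φ y) := by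
      rw [← map_smul, ← map_smul, e1, e2]
      simp only [map_sum, map_smul]
      refine Finset.sum_congr rfl fun k _ => Finset.sum_congr rfl fun l _ => ?_
      rw [hψ, hh]
      congr 1
      exact (mapMatrix_elemSkew (algebraMap F R) k l).symm
    exact smul_right_injective _ h2 e3
  obtain ⟨_, ⟨g, rfl⟩, hg⟩ := hφ.exists_intertwiner h2 hn hn8
  refine ⟨(conjAlgHom hᵀ h hh1 hh2).comp ((Algebra.ofId F R).mapMatrix.comp
    (conjAlgHom (g : Matrix (Fin n) (Fin n) F) (↑g⁻¹ : Matrix (Fin n) (Fin n) F)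
      g.mul_inv g.inv_mul)), fun y hy => ?_⟩
  have e : φ y = g * (y * (↑g⁻¹ : Matrix (Fin n) (Fin n) F)) := by
    rw [← mul_assoc, ← hg y hy, mul_assoc, g.mul_inv, mul_one]
  rw [AlgHom.comp_apply, AlgHom.comp_apply, conjAlgHom_apply, conjAlgHom_apply, ← e, ← hall y hy]
  calc hᵀ * (h * η y * hᵀ * h) = (hᵀ * h) * η y * (hᵀ * h) := by noncomm_ring
    _ = η y := by rw [hh1, one_mul, mul_one]

end extension

section coaction
variable {F : Type*} [Field F] {n : ℕ}

theorem single_eq_mul_elemSkew (R : Type*) [CommRing R] (hn : 5 ≤ n) (i j : Fin n) :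
    ∃ a b c d : Matrix (Fin n) (Fin n) R, aᵀ = -a ∧ bᵀ = -b ∧ cᵀ = -c ∧ dᵀ = -d ∧
      Matrix.single i j 1 = a * b * (c * d) := by
  obtain ⟨p, hp⟩ := exists_notMem_of_length_lt [i, j] (by simp; omega)
  obtain ⟨k, hk⟩ := exists_notMem_of_length_lt [i, p] (by simp; omega)
  obtain ⟨l, hl⟩ := exists_notMem_of_length_lt [p, j] (by simp; omega)
  obtain ⟨hpi, hpj⟩ : p ≠ i ∧ p ≠ j := by simpa using hp
  obtain ⟨hki, hkp⟩ : k ≠ i ∧ k ≠ p := by simpa using hk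
  obtain ⟨hlp, hlj⟩ : l ≠ p ∧ l ≠ j := by simpa using hl
  refine ⟨elemSkew R i k, elemSkew R k p, elemSkew R p l, elemSkew R l j, transpose_elemSkew _ _,
    transpose_elemSkew _ _, transpose_elemSkew _ _, transpose_elemSkew _ _, ?_⟩
  rw [elemSkew_mul_elemSkew hki.symm hkp hpi.symm, elemSkew_mul_elemSkew hlp.symm hlj hpj,
    ← Matrix.single_eq_single_vecMulVec_single, ← Matrix.single_eq_single_vecMulVec_single,
    Matrix.single_mul_single_same, one_mul]

theorem algHom_eq_of_forall_skew (hn : 5 ≤ n) {B : Type*} [Ring B] [Algebra F B]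
    {Φ Ψ : Matrix (Fin n) (Fin n) F →ₐ[F] B} (h : ∀ x, xᵀ = -x → Φ x = Ψ x) : Φ = Ψ := by
  refine AlgHom.toLinearMap_injective ((Matrix.stdBasis F (Fin n) (Fin n)).ext fun ij => ?_)
  obtain ⟨a, b, c, d, ha, hb, hc, hd, e⟩ := single_eq_mul_elemSkew F hn ij.1 ij.2
  rw [← Prod.mk.eta (p := ij), Matrix.stdBasis_eq_single, e]
  simp only [AlgHom.toLinearMap_apply, map_mul, h _ ha, h _ hb, h _ hc, h _ hd]

theorem eq_zero_of_forall_mem_pow_isMaximal {A : Type*} [CommRing A] [IsNoetherianRing A] {r : A}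
    (hr : ∀ m : Ideal A, m.IsMaximal → ∀ k : ℕ, r ∈ m ^ (k + 1)) : r = 0 := by
  by_contra hr0
  obtain ⟨m, hm, hle⟩ := Ideal.exists_le_maximal (LinearMap.ker (LinearMap.toSpanSingleton A A r))
    (by
      rw [Ne, Ideal.eq_top_iff_one, LinearMap.mem_ker]
      simpa using hr0)
  have hmem : r ∈ ⨅ i : ℕ, m ^ i • (⊤ : Submodule A A) := by
    rw [Submodule.mem_iInf]
    intro i
    have := Ideal.pow_le_pow_right (Nat.le_succ i) (hr m hm i)
    simpa using this
  obtain ⟨s, hs⟩ := (m.mem_iInf_smul_pow_eq_bot_iff r).1 hmem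
  have h1 : (1 - s : A) ∈ m := hle (by
    rw [LinearMap.mem_ker, LinearMap.toSpanSingleton_apply, sub_smul, one_smul]
    exact sub_eq_zero.2 hs.symm)
  exact hm.ne_top ((Ideal.eq_top_iff_one _).2 (by simpa using m.add_mem h1 s.2))

theorem exists_algHom_ker_eq_of_isMaximal [IsAlgClosed F] {A : Type*} [CommRing A] [Algebra F A]
    [Algebra.FiniteType F A] (m : Ideal A) [hm : m.IsMaximal] :
    ∃ ε : A →ₐ[F] F, RingHom.ker ε = m := by
  let := Ideal.Quotient.field m
  have : Algebra.FiniteType F (A ⧸ m) :=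
    Algebra.FiniteType.of_surjective (Ideal.Quotient.mkₐ F m) (Ideal.Quotient.mkₐ_surjective F m)
  have : Module.Finite F (A ⧸ m) := finite_of_finite_type_of_isJacobsonRing F (A ⧸ m)
  have hb : Function.Bijective (Algebra.ofId F (A ⧸ m)) :=
    IsAlgClosed.algebraMap_bijective_of_isIntegral
  refine ⟨(AlgEquiv.ofBijective _ hb).symm.toAlgHom.comp (Ideal.Quotient.mkₐ F m), ?_⟩
  ext x
  rw [RingHom.mem_ker, AlgHom.comp_apply]
  simp [Ideal.Quotient.eq_zero_iff_mem]

theorem exists_algHom_extending_skew_of_isMaximal [IsAlgClosed F] (h2 : (2 : F) ≠ 0) (hn : 5 ≤ n)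
    (hn8 : n ≠ 8) {A : Type*} [CommRing A] [Algebra F A] [Algebra.FiniteType F A]
    {η : Matrix (Fin n) (Fin n) F →ₗ[F] Matrix (Fin n) (Fin n) A}
    (hskew : ∀ x, xᵀ = -x → (η x)ᵀ = -η x)
    (hlie : ∀ x y, xᵀ = -x → yᵀ = -y → η ⁅x, y⁆ = ⁅η x, η y⁆)
    (hinj : ∀ ε : A →ₐ[F] F, ∀ x, xᵀ = -x → ε.mapMatrix (η x) = 0 → x = 0)
    (m : Ideal A) [hm : m.IsMaximal] (k : ℕ) :
    ∃ Φ : Matrix (Fin n) (Fin n) F →ₐ[F] Matrix (Fin n) (Fin n) (A ⧸ m ^ (k + 1)),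
      ∀ x, xᵀ = -x → Φ x = (Ideal.Quotient.mkₐ F (m ^ (k + 1))).mapMatrix (η x) := by
  obtain ⟨ε, rfl⟩ := exists_algHom_ker_eq_of_isMaximal (F := F) m
  set m := RingHom.ker ε
  set q := Ideal.Quotient.mkₐ F (m ^ (k + 1))
  have hle : ∀ a ∈ m ^ (k + 1), ε a = 0 := fun a ha => by
    have : a ∈ RingHom.ker ε := Ideal.pow_le_self k.succ_ne_zero ha
    exact this
  refine exists_algHom_extending_skew h2 hn hn8 (Ideal.Quotient.liftₐ (m ^ (k + 1)) ε hle)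
    ⟨k + 1, ?_⟩ (q.mapMatrix.toLinearMap ∘ₗ η) ?_ ?_ ?_
  · have : RingHom.ker (Ideal.Quotient.liftₐ (m ^ (k + 1)) ε hle) =
        m.map (Ideal.Quotient.mk (m ^ (k + 1))) := by
      exact Ideal.ker_quotient_lift _ _
    rw [this, ← Ideal.map_pow, Ideal.map_quotient_self]
    rfl
  · intro x hx
    rw [LinearMap.comp_apply, AlgHom.toLinearMap_apply, ← map_neg, ← hskew x hx,
      AlgHom.mapMatrix_apply, AlgHom.mapMatrix_apply, Matrix.transpose_map]
  · intro x y hx hy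
    rw [LinearMap.comp_apply, hlie x y hx hy]
    simp only [Ring.lie_def, LinearMap.comp_apply, AlgHom.toLinearMap_apply, map_sub, map_mul]
  · intro x hx h0
    refine hinj ε x hx ?_
    rw [← h0]
    rfl

theorem exists_algHom_extending_skew_of_finiteType [IsAlgClosed F] (h2 : (2 : F) ≠ 0) (hn : 5 ≤ n)
    (hn8 : n ≠ 8) {A : Type*} [CommRing A] [Algebra F A] [Algebra.FiniteType F A]
    {η : Matrix (Fin n) (Fin n) F →ₗ[F] Matrix (Fin n) (Fin n) A}
    (hskew : ∀ x, xᵀ = -x → (η x)ᵀ = -η x)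
    (hlie : ∀ x y, xᵀ = -x → yᵀ = -y → η ⁅x, y⁆ = ⁅η x, η y⁆)
    (hinj : ∀ ε : A →ₐ[F] F, ∀ x, xᵀ = -x → ε.mapMatrix (η x) = 0 → x = 0) :
    ∃ Φ : Matrix (Fin n) (Fin n) F →ₐ[F] Matrix (Fin n) (Fin n) A, ∀ x, xᵀ = -x → Φ x = η x := by
  have : IsNoetherianRing A := Algebra.FiniteType.isNoetherianRing F A
  choose a b c d ha hb hc hd habcd using single_eq_mul_elemSkew (n := n) F hn
  set φ : Matrix (Fin n) (Fin n) F →ₗ[F] Matrix (Fin n) (Fin n) A :=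
    (Matrix.stdBasis F (Fin n) (Fin n)).constr F fun ij =>
      η (a ij.1 ij.2) * η (b ij.1 ij.2) * (η (c ij.1 ij.2) * η (d ij.1 ij.2)) with hφ
  have key (m : Ideal A) (hm : m.IsMaximal) (k : ℕ) :
      ∃ Φ : Matrix (Fin n) (Fin n) F →ₐ[F] Matrix (Fin n) (Fin n) (A ⧸ m ^ (k + 1)),
        (∀ x, Φ x = (Ideal.Quotient.mkₐ F (m ^ (k + 1))).mapMatrix (φ x)) ∧
        ∀ x, xᵀ = -x → Φ x = (Ideal.Quotient.mkₐ F (m ^ (k + 1))).mapMatrix (η x) := by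
    obtain ⟨Φ, hΦ⟩ := exists_algHom_extending_skew_of_isMaximal h2 hn hn8 hskew hlie hinj m k
    refine ⟨Φ, fun x => ?_, hΦ⟩
    have : Φ.toLinearMap =
        (Ideal.Quotient.mkₐ F (m ^ (k + 1))).mapMatrix.toLinearMap ∘ₗ φ := by
      refine (Matrix.stdBasis F (Fin n) (Fin n)).ext fun ij => ?_
      rw [LinearMap.comp_apply, hφ, Module.Basis.constr_basis, AlgHom.toLinearMap_apply,
        AlgHom.toLinearMap_apply, ← Prod.mk.eta (p := ij), Matrix.stdBasis_eq_single,
        habcd ij.1 ij.2]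
      simp only [map_mul, hΦ _ (ha _ _), hΦ _ (hb _ _), hΦ _ (hc _ _), hΦ _ (hd _ _)]
    exact LinearMap.congr_fun this x
  have hzero {x y : Matrix (Fin n) (Fin n) A} (h : ∀ m : Ideal A, m.IsMaximal → ∀ k : ℕ,
      (Ideal.Quotient.mkₐ F (m ^ (k + 1))).mapMatrix x =
      (Ideal.Quotient.mkₐ F (m ^ (k + 1))).mapMatrix y) : x = y := by
    ext p q
    refine sub_eq_zero.1 (eq_zero_of_forall_mem_pow_isMaximal fun m hm k => ?_)
    rw [← Ideal.Quotient.eq]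
    exact congrFun (congrFun (h m hm k) p) q
  refine ⟨AlgHom.ofLinearMap φ ?_ ?_, fun x hx => ?_⟩
  · refine hzero fun m hm k => ?_
    obtain ⟨Φ, hΦ, -⟩ := key m hm k
    rw [← hΦ, map_one, map_one]
  · intro x y
    refine hzero fun m hm k => ?_
    obtain ⟨Φ, hΦ, -⟩ := key m hm k
    rw [← hΦ, map_mul, map_mul, hΦ, hΦ]
  · refine hzero fun m hm k => ?_
    obtain ⟨Φ, hΦ, hΦ'⟩ := key m hm k
    rw [AlgHom.ofLinearMap_apply, ← hΦ, hΦ' x hx]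

end coaction

section grading

theorem iSupIndep.exists_linearMap {K ι V W : Type*} [Field K] [AddCommGroup V] [Module K V]
    [AddCommGroup W] [Module K W] {p : ι → Submodule K V} (hp : iSupIndep p)
    (f : ι → V →ₗ[K] W) : ∃ η : V →ₗ[K] W, ∀ i, ∀ x ∈ p i, η x = f i x := by
  classical
  obtain ⟨L, hL⟩ := LinearMap.exists_leftInverse_of_injective
    (DFinsupp.lsum ℕ fun i => (p i).subtype) (LinearMap.ker_eq_bot.2 hp.dfinsupp_lsum_injective)
  refine ⟨DFinsupp.lsum ℕ (fun i => f i ∘ₗ (p i).subtype) ∘ₗ L, fun i x hx => ?_⟩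
  have h1 : L x = DFinsupp.single i ⟨x, hx⟩ := by
    have := LinearMap.congr_fun hL (DFinsupp.single i ⟨x, hx⟩)
    rw [LinearMap.comp_apply, DFinsupp.lsum_single] at this
    exact this
  rw [LinearMap.comp_apply, h1, DFinsupp.lsum_single]
  rfl

theorem Subgroup.exists_monoidAlgebra_coeff (F : Type*) [Field F] {G : Type*} [CommGroup G]
    (H : Subgroup G) : ∃ (c : G → MonoidAlgebra F H) (κ : G → MonoidAlgebra F H →ₗ[F] F),
      (∀ g ∈ H, ∀ h ∈ H, c (g * h) = c g * c h) ∧ (∀ g ∈ H, IsUnit (c g)) ∧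
      (∀ g ∉ H, c g = 0) ∧ (∀ g ∈ H, κ g (c g) = 1) ∧ ∀ g h, h ≠ g → κ g (c h) = 0 := by
  classical
  set c : G → MonoidAlgebra F H := fun g =>
    if hg : g ∈ H then MonoidAlgebra.of F H ⟨g, hg⟩ else 0 with hc
  have hcm {g : G} (hg : g ∈ H) : c g = MonoidAlgebra.of F H ⟨g, hg⟩ := dif_pos hg
  have hcn {g : G} (hg : g ∉ H) : c g = 0 := dif_neg hg
  set κ : G → MonoidAlgebra F H →ₗ[F] F := fun g => if hg : g ∈ H then
    Finsupp.lapply ⟨g, hg⟩ ∘ₗ (MonoidAlgebra.coeffLinearEquiv F).toLinearMap else 0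
  have hκ {g : G} (hg : g ∈ H) : κ g = Finsupp.lapply ⟨g, hg⟩ ∘ₗ
    (MonoidAlgebra.coeffLinearEquiv F).toLinearMap := dif_pos hg
  have hκn {g : G} (hg : g ∉ H) : κ g = 0 := dif_neg hg
  refine ⟨c, κ, fun g hg h hh => ?_, fun g hg => ?_, fun g hg => hcn hg, fun g hg => ?_, fun g h hne => ?_⟩
  · rw [hcm hg, hcm hh, hcm (H.mul_mem hg hh), ← map_mul]
    rfl
  · rw [hcm hg]
    exact (Group.isUnit _).map _
  · rw [hcm hg, hκ hg]
    exact Finsupp.single_eq_same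
  · by_cases hg : g ∈ H
    · by_cases hh : h ∈ H
      · rw [hcm hh, hκ hg]
        exact Finsupp.single_eq_of_ne fun he => hne (congrArg Subtype.val he).symm
      · rw [hcn hh, map_zero]
    · rw [hκn hg, LinearMap.zero_apply]

variable {F : Type*} [Field F] {n : ℕ} {G : Type*} [CommGroup G]

theorem exists_coaction [IsAlgClosed F] (h2 : (2 : F) ≠ 0) (hn : 5 ≤ n) (hn8 : n ≠ 8)
    {ℒ : G → Submodule F (Matrix (Fin n) (Fin n) F)} (hsub : ∀ g : G, ℒ g ≤ skewMatrix F n)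
    (hind : iSupIndep ℒ) (hsup : (⨆ g : G, ℒ g) = skewMatrix F n)
    (hbr : ∀ g h : G, ∀ x ∈ ℒ g, ∀ y ∈ ℒ h, x * y - y * x ∈ ℒ (g * h))
    {A : Type*} [CommRing A] [Algebra F A] [Algebra.FiniteType F A] {H : Subgroup G}
    (hH : ∀ g, ℒ g ≠ ⊥ → g ∈ H) {c : G → A} (hmul : ∀ g ∈ H, ∀ h ∈ H, c (g * h) = c g * c h)
    (hunit : ∀ g ∈ H, IsUnit (c g)) :
    ∃ Φ : Matrix (Fin n) (Fin n) F →ₐ[F] Matrix (Fin n) (Fin n) A,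
      ∀ g, ∀ x ∈ ℒ g, Φ x = c g • (Algebra.ofId F A).mapMatrix x := by
  set ι : Matrix (Fin n) (Fin n) F →ₐ[F] Matrix (Fin n) (Fin n) A :=
    (Algebra.ofId F A).mapMatrix with hι
  obtain ⟨η, hη⟩ := hind.exists_linearMap fun g => c g • ι.toLinearMap
  have hη' (g) (x) (hx : x ∈ ℒ g) : η x = c g • ι x := hη g x hx
  have hιt (x : Matrix (Fin n) (Fin n) F) : (ι x)ᵀ = ι xᵀ := by
    rw [hι, AlgHom.mapMatrix_apply, AlgHom.mapMatrix_apply, Matrix.transpose_map]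
  have hmem {g : G} {x} (hx : x ∈ ℒ g) (h0 : x ≠ 0) : g ∈ H :=
    hH g fun h => h0 ((Submodule.mem_bot F).1 (h ▸ hx))
  have hskew (x : Matrix (Fin n) (Fin n) F) (hx : xᵀ = -x) : (η x)ᵀ = -η x := by
    have hx' : x ∈ ⨆ g, ℒ g := hsup.symm ▸ hx
    clear hx
    induction hx' using Submodule.iSup_induction' with
    | mem g x hxg => rw [hη' g x hxg, Matrix.transpose_smul, hιt, hsub g hxg, map_neg, smul_neg]
    | zero => simp
    | add x y hx hy ihx ihy =>
      rw [map_add, Matrix.transpose_add, ihx, ihy, neg_add]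
  have hlie (x y : Matrix (Fin n) (Fin n) F) (hx : xᵀ = -x) (hy : yᵀ = -y) :
      η ⁅x, y⁆ = ⁅η x, η y⁆ := by
    have hx' : x ∈ ⨆ g, ℒ g := hsup.symm ▸ hx
    have hy' : y ∈ ⨆ g, ℒ g := hsup.symm ▸ hy
    clear hx hy
    simp only [Ring.lie_def]
    induction hx' using Submodule.iSup_induction' with
    | mem g x hxg =>
      induction hy' using Submodule.iSup_induction' with
      | mem h y hyh =>
        by_cases hx0 : x = 0
        · simp [hx0]
        by_cases hy0 : y = 0
        · simp [hy0]
        rw [hη' _ _ (hbr g h x hxg y hyh), hη' _ _ hxg, hη' _ _ hyh,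
          hmul g (hmem hxg hx0) h (hmem hyh hy0), map_sub, map_mul, map_mul,
          smul_mul_smul_comm, smul_mul_smul_comm, mul_comm (c h), smul_sub]
      | zero => simp
      | add y z hy hz ihy ihz =>
        rw [show x * (y + z) - (y + z) * x = (x * y - y * x) + (x * z - z * x) by noncomm_ring,
          map_add, map_add, ihy, ihz]
        noncomm_ring
    | zero => simp
    | add x z hx hz ihx ihz =>
      rw [show (x + z) * y - y * (x + z) = (x * y - y * x) + (z * y - y * z) by noncomm_ring,
        map_add, map_add, ihx, ihz]
      noncomm_ring
  obtain ⟨Φ, hΦ⟩ := exists_algHom_extending_skew_of_finiteType h2 hn hn8 hskew hlie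
    fun ε x hx h0 => by
      obtain ⟨θ, hθ⟩ := hind.exists_linearMap fun g =>
        (ε (c g))⁻¹ • (LinearMap.id : Matrix (Fin n) (Fin n) F →ₗ[F] _)
      have hx' : x ∈ ⨆ g, ℒ g := hsup.symm ▸ hx
      have hid : θ (ε.mapMatrix (η x)) = x := by
        clear h0 hx
        induction hx' using Submodule.iSup_induction' with
        | mem g x hxg =>
          by_cases hx0 : x = 0
          · simp [hx0]
          have hne : ε (c g) ≠ 0 := ((hunit g (hmem hxg hx0)).map ε).ne_zero
          have e : ε.mapMatrix (η x) = ε (c g) • x := by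
            rw [hη' g x hxg]
            ext p q
            simp [hι, Algebra.ofId_apply]
          rw [e, map_smul, hθ g x hxg, LinearMap.smul_apply, LinearMap.id_apply, smul_smul,
            mul_inv_cancel₀ hne, one_smul]
        | zero => simp
        | add x y hx hy ihx ihy => rw [map_add, map_add, map_add, ihx, ihy]
      rw [← hid, h0, map_zero]
  exact ⟨Φ, fun g x hx => by rw [hΦ x (hsub g hx), hη' g x hx]⟩

end grading

section grading
variable {F : Type*} [Field F] {n : ℕ} {G : Type*} [CommGroup G]

theorem exists_grading_of_coaction (hn : 5 ≤ n)
    {ℒ : G → Submodule F (Matrix (Fin n) (Fin n) F)} (hsub : ∀ g : G, ℒ g ≤ skewMatrix F n)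
    (hsup : (⨆ g : G, ℒ g) = skewMatrix F n) {A : Type*} [CommRing A] [Algebra F A] [Nontrivial A]
    {H : Subgroup G} {c : G → A} {κ : G → A →ₗ[F] F}
    (hmul : ∀ g ∈ H, ∀ h ∈ H, c (g * h) = c g * c h) (hzero : ∀ g ∉ H, c g = 0)
    (hone : ∀ g ∈ H, κ g (c g) = 1) (hne : ∀ g h, h ≠ g → κ g (c h) = 0)
    (Φ : Matrix (Fin n) (Fin n) F →ₐ[F] Matrix (Fin n) (Fin n) A)
    (hΦ : ∀ g, ∀ x ∈ ℒ g, Φ x = c g • (Algebra.ofId F A).mapMatrix x) :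
    ∃ ℛ : G → Submodule F (Matrix (Fin n) (Fin n) F),
      iSupIndep ℛ ∧ (⨆ g, ℛ g) = ⊤ ∧
      (∀ g h : G, ∀ x ∈ ℛ g, ∀ y ∈ ℛ h, x * y ∈ ℛ (g * h)) ∧
      (∀ g : G, ∀ x ∈ ℛ g, xᵀ ∈ ℛ g) ∧
      (∀ g : G, ℒ g = ℛ g ⊓ skewMatrix F n) := by
  have : Nonempty (Fin n) := ⟨⟨0, by omega⟩⟩
  have hinj : Function.Injective Φ := Φ.toRingHom.injective
  set ι : Matrix (Fin n) (Fin n) F →ₐ[F] Matrix (Fin n) (Fin n) A :=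
    (Algebra.ofId F A).mapMatrix with hι
  set ℛ : G → Submodule F (Matrix (Fin n) (Fin n) F) := fun g =>
    LinearMap.eqLocus Φ.toLinearMap (c g • ι.toLinearMap) with hℛ
  have hmem {g x} : x ∈ ℛ g ↔ Φ x = c g • ι x := Iff.rfl
  have hnot {g x} (hg : g ∉ H) (hx : x ∈ ℛ g) : x = 0 := by
    rw [hmem, hzero g hg, zero_smul] at hx
    exact hinj (hx.trans (map_zero Φ).symm)
  set P : G → Matrix (Fin n) (Fin n) F →ₗ[F] Matrix (Fin n) (Fin n) F := fun g =>
    (κ g).mapMatrix ∘ₗ Φ.toLinearMap with hP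
  have hPa {g h x} (hx : x ∈ ℛ h) : P g x = κ g (c h) • x := by
    ext p q
    have e : P g x p q = κ g (Φ x p q) := rfl
    rw [e, hmem.1 hx, Matrix.smul_apply, hι, AlgHom.mapMatrix_apply, Matrix.map_apply, smul_eq_mul,
      mul_comm, Algebra.ofId_apply, ← Algebra.smul_def, map_smul, Matrix.smul_apply, smul_eq_mul,
      smul_eq_mul, mul_comm]
  have hP1 {g x} (hx : x ∈ ℛ g) : P g x = x := by
    by_cases hg : g ∈ H
    · rw [hPa hx, hone g hg, one_smul]
    · rw [hnot hg hx, map_zero]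
  have hP0 {g h x} (hgh : h ≠ g) (hx : x ∈ ℛ h) : P g x = 0 := by
    rw [hPa hx, hne g h hgh, zero_smul]
  have hle (g) : ℒ g ≤ ℛ g := fun x hx => hΦ g x hx
  have hmulR (g h : G) (x) (hx : x ∈ ℛ g) (y) (hy : y ∈ ℛ h) : x * y ∈ ℛ (g * h) := by
    by_cases hg : g ∈ H
    · by_cases hh : h ∈ H
      · rw [hmem, map_mul, map_mul, hmem.1 hx, hmem.1 hy, hmul g hg h hh, smul_mul_smul_comm]
      · rw [hnot hh hy, mul_zero]
        exact zero_mem _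
    · rw [hnot hg hx, zero_mul]
      exact zero_mem _
  refine ⟨ℛ, fun g => ?_, ?_, hmulR, fun g x hx => ?_, fun g => le_antisymm ?_ ?_⟩
  · rw [Submodule.disjoint_def]
    intro x hx hx'
    have hker : (⨆ (j : G) (_ : j ≠ g), ℛ j) ≤ LinearMap.ker (P g) :=
      iSup₂_le fun j hj y hy => hP0 hj hy
    rw [← hP1 hx]
    exact hker hx'
  · have hmulS (x y) (hx : x ∈ ⨆ g, ℛ g) (hy : y ∈ ⨆ g, ℛ g) : x * y ∈ ⨆ g, ℛ g := by
      induction hx using Submodule.iSup_induction' with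
      | mem g x hxg =>
        induction hy using Submodule.iSup_induction' with
        | mem h y hyh => exact Submodule.mem_iSup_of_mem (g * h) (hmulR g h x hxg y hyh)
        | zero => simp
        | add y z _ _ ihy ihz => rw [mul_add]; exact add_mem ihy ihz
      | zero => simp
      | add x z _ _ ihx ihz => rw [add_mul]; exact add_mem ihx ihz
    have hsk (x : Matrix (Fin n) (Fin n) F) (hx : xᵀ = -x) : x ∈ ⨆ g, ℛ g := by
      have : x ∈ ⨆ g, ℒ g := hsup.symm ▸ hx
      exact iSup_mono hle this
    rw [eq_top_iff]
    intro x _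
    rw [Matrix.matrix_eq_sum_single x]
    refine sum_mem fun i _ => sum_mem fun j _ => ?_
    obtain ⟨a, b, c, d, ha, hb, hc, hd, e⟩ := single_eq_mul_elemSkew F hn i j
    have : Matrix.single i j (x i j) = x i j • Matrix.single i j (1 : F) := by
      rw [Matrix.smul_single, smul_eq_mul, mul_one]
    rw [this, e]
    exact Submodule.smul_mem _ _ (hmulS _ _ (hmulS _ _ (hsk a ha) (hsk b hb))
      (hmulS _ _ (hsk c hc) (hsk d hd)))
  · have htr : (AlgHom.ofLinearMap
        ((Matrix.transposeLinearEquiv (Fin n) (Fin n) F A).toLinearMap ∘ₗ Φ.toLinearMap ∘ₗ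
          (Matrix.transposeLinearEquiv (Fin n) (Fin n) F F).toLinearMap)
        (by simp) (fun x y => by simp) :
        Matrix (Fin n) (Fin n) F →ₐ[F] Matrix (Fin n) (Fin n) A) = Φ := by
      refine algHom_eq_of_forall_skew hn fun x hx => ?_
      have hx' : x ∈ ⨆ g, ℒ g := hsup.symm ▸ hx
      clear hx
      change (Φ xᵀ)ᵀ = Φ x
      induction hx' using Submodule.iSup_induction' with
      | mem g x hxg =>
        have e : xᵀ = -x := hsub g hxg
        have e' : (ι x)ᵀ = ι xᵀ := by
          rw [hι, AlgHom.mapMatrix_apply, AlgHom.mapMatrix_apply, Matrix.transpose_map]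
        rw [e, map_neg, hΦ g x hxg, Matrix.transpose_neg, Matrix.transpose_smul, e', e, map_neg,
          smul_neg, neg_neg]
      | zero => simp
      | add x y _ _ ihx ihy =>
        rw [Matrix.transpose_add, map_add, Matrix.transpose_add, ihx, ihy, map_add]
    have e : (Φ xᵀ)ᵀ = Φ x := AlgHom.congr_fun htr x
    rw [hmem, ← Matrix.transpose_transpose (Φ xᵀ), e, hmem.1 hx, Matrix.transpose_smul, hι,
      AlgHom.mapMatrix_apply, AlgHom.mapMatrix_apply, Matrix.transpose_map]
  · exact le_inf (hle g) (hsub g)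
  · rintro x ⟨hx, hxs⟩
    have hcomap : (⨆ h, ℒ h) ≤ (ℒ g).comap (P g) := iSup_le fun h y hy => by
      rw [Submodule.mem_comap]
      by_cases hgh : h = g
      · subst hgh
        rwa [hP1 (hle h hy)]
      · rw [hP0 hgh (hle h hy)]
        exact zero_mem _
    rw [← hP1 hx]
    exact hcomap (hsup.symm ▸ hxs)

end grading

/-- Every `G`-grading of the Lie algebra `so_n(F)` (`n ≥ 5`, `n ≠ 8`,
`char F ≠ 2`) is the restriction of a `G`-grading of the associative algebra
`Mₙ(F)` whose components are invariant under transpose. -/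
theorem so_grading_lifts
    {F : Type*} [Field F] [IsAlgClosed F] (hchar : ringChar F ≠ 2)
    {G : Type*} [CommGroup G] [DecidableEq G] {n : ℕ} (hn : 5 ≤ n) (hn8 : n ≠ 8)
    (ℒ : G → Submodule F (Matrix (Fin n) (Fin n) F))
    (hsub : ∀ g : G, ℒ g ≤ skewMatrix F n)
    (hind : iSupIndep ℒ)
    (hsup : (⨆ g : G, ℒ g) = skewMatrix F n)
    (hbr : ∀ g h : G, ∀ x ∈ ℒ g, ∀ y ∈ ℒ h, x * y - y * x ∈ ℒ (g * h)) :
    ∃ ℛ : G → Submodule F (Matrix (Fin n) (Fin n) F),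
      DirectSum.IsInternal ℛ ∧
      (∀ g h : G, ∀ x ∈ ℛ g, ∀ y ∈ ℛ h, x * y ∈ ℛ (g * h)) ∧
      (∀ g : G, ∀ x ∈ ℛ g, xᵀ ∈ ℛ g) ∧
      (∀ g : G, ℒ g = ℛ g ⊓ skewMatrix F n) := by
  have h2 : (2 : F) ≠ 0 := Ring.two_ne_zero hchar
  have hfin : {g | ℒ g ≠ ⊥}.Finite := WellFoundedGT.finite_ne_bot_of_iSupIndep hind
  have hfg : (Subgroup.closure {g | ℒ g ≠ ⊥}).FG := ⟨hfin.toFinset, by simp⟩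
  have : Group.FG (Subgroup.closure {g | ℒ g ≠ ⊥}) := (Group.fg_iff_subgroup_fg _).2 hfg
  obtain ⟨c, κ, hmul, hunit, hzero, hone, hne⟩ :=
    (Subgroup.closure {g | ℒ g ≠ ⊥}).exists_monoidAlgebra_coeff F
  obtain ⟨Φ, hΦ⟩ := exists_coaction h2 hn hn8 hsub hind hsup hbr
    (fun g hg => Subgroup.subset_closure hg) hmul hunit
  obtain ⟨ℛ, hi, ht, hm, htr, hL⟩ :=
    exists_grading_of_coaction hn hsub hsup hmul hzero hone hne Φ hΦ
  exact ⟨ℛ, DirectSum.isInternal_submodule_of_iSupIndep_of_iSup_eq_top hi ht, hm, htr, hL⟩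
end
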